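/- Let R be a standard graded ring of dimension d ≥ 2 over an algebraically closed field of characteristic p, I a homogeneous ideal of finite colength, and M a finitely generated graded module. Suppose M' → M'' is a degree-preserving map of finitely generated graded R-modules whose kernel and cokernel have dimension < d. Then the HK density functions agree: HKd(M', I) = HKd(M'', I). -/

import Mathlib

open Filter Topology

/-- The `q`-th Frobenius power `I^{[q]}` of an ideal. -/
def frobeniusPower {R : Type*} [CommRing R] (I : Ideal R) (q : ℕ) : Ideal R :=
  Ideal.span ((fun x => x ^ q) '' (I : Set R))

/-- `ℓ(M/I^{[q]}M)_m`. -/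
noncomputable def gradedPieceLength {k R M : Type*} [Field k] [CommRing R] [Algebra k R]
    [AddCommGroup M] [Module R M] [Module k M] [IsScalarTower k R M]
    (ℳ : ℕ → Submodule k M) (I : Ideal R) (q m : ℕ) : ℕ :=
  Module.finrank k
    ((ℳ m).map ((frobeniusPower I q • (⊤ : Submodule R M)).mkQ.restrictScalars k))

/-- The step function `f_n(x) = (1/q^{d-1})·ℓ(M/I^{[q]}M)_{⌊xq⌋}`, `q = p^n`. -/
noncomputable def hkStep {k R M : Type*} [Field k] [CommRing R] [Algebra k R]
    [AddCommGroup M] [Module R M] [Module k M] [IsScalarTower k R M]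
    (ℳ : ℕ → Submodule k M) (I : Ideal R) (d p n : ℕ) (x : ℝ) : ℝ :=
  if x < 0 then 0
  else (gradedPieceLength ℳ I (p ^ n) (Nat.floor (x * (p : ℝ) ^ n)) : ℝ) /
    (p : ℝ) ^ (n * (d - 1))

section Dimension

variable {R : Type*} [CommRing R]

/-- Every chain of primes containing `𝔞` has length at most `D`; that is, `dim R/𝔞 ≤ D`. -/
def ChainBound (𝔞 : Ideal R) (D : ℕ) : Prop :=
  ∀ l : LTSeries (PrimeSpectrum R), 𝔞 ≤ l.head.asIdeal → l.length ≤ D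

lemma chainBound_of_ringKrullDim_quotient_le {𝔞 : Ideal R} {D : ℕ}
    (h : ringKrullDim (R ⧸ 𝔞) ≤ D) : ChainBound 𝔞 D := by
  intro l hl
  rw [ringKrullDim_quotient] at h
  have hmem : ∀ i, l i ∈ PrimeSpectrum.zeroLocus (R := R) 𝔞 := fun i =>
    hl.trans (show l.head ≤ l i from l.head_le i)
  let l' : LTSeries (PrimeSpectrum.zeroLocus (R := R) 𝔞) :=
    { length := l.length
      toFun := fun i => ⟨l i, hmem i⟩
      step := fun i => l.step i }
  exact_mod_cast (Order.LTSeries.length_le_krullDim l').trans h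

lemma chainBound_bot_of_ringKrullDim_le {D : ℕ} (h : ringKrullDim R ≤ D) :
    ChainBound (⊥ : Ideal R) D := fun l _ => by
  exact_mod_cast (Order.LTSeries.length_le_krullDim l).trans h

lemma LTSeries.length_eq_zero_of_isMaximal_head (l : LTSeries (PrimeSpectrum R))
    (h : l.head.asIdeal.IsMaximal) : l.length = 0 := by
  by_contra hne
  have hlt : l.head < l.last := l.strictMono (by
    rw [Fin.lt_def]; simpa [Fin.last] using Nat.pos_of_ne_zero hne)
  exact hlt.ne (PrimeSpectrum.ext (h.eq_of_le l.last.2.ne_top hlt.le))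

lemma ChainBound.isArtinianRing_quotient [IsNoetherianRing R] {𝔞 : Ideal R}
    (h : ChainBound 𝔞 0) : IsArtinianRing (R ⧸ 𝔞) := by
  rw [isArtinianRing_iff_krullDimLE_zero]
  refine Ring.KrullDimLE.mk₀ fun P hP => ?_
  obtain ⟨m, hm, hPm⟩ := Ideal.exists_le_maximal P hP.ne_top
  rcases eq_or_lt_of_le hPm with rfl | hlt
  · exact hm
  exfalso
  let π := Ideal.Quotient.mk 𝔞
  have hπ : Function.Surjective π := Ideal.Quotient.mk_surjective
  let p : PrimeSpectrum R := ⟨P.comap π, inferInstance⟩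
  let r : PrimeSpectrum R := ⟨m.comap π, have := hm.isPrime; inferInstance⟩
  have hpr : p < r := by
    refine lt_of_le_of_ne (Ideal.comap_mono hPm) fun he => hlt.ne ?_
    exact Ideal.comap_injective_of_surjective π hπ (congrArg PrimeSpectrum.asIdeal he)
  have hap : 𝔞 ≤ p.asIdeal := fun x hx => by
    change π x ∈ P
    rw [show π x = 0 from Ideal.Quotient.eq_zero_iff_mem.mpr hx]
    exact P.zero_mem
  let l : LTSeries (PrimeSpectrum R) := RelSeries.singleton _ r
  exact absurd (h (l.cons p hpr) hap) (Nat.not_succ_le_zero _)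

/-- If no minimal prime of `𝔞` of positive coheight contains `𝔟`, the dimension drops. -/
lemma ChainBound.of_minimalPrimes {𝔞 𝔟 : Ideal R} {D : ℕ} (h : ChainBound 𝔞 (D + 1))
    (hab : 𝔞 ≤ 𝔟)
    (hmin : ∀ P ∈ 𝔞.minimalPrimes, 𝔟 ≤ P → ∀ l : LTSeries (PrimeSpectrum R),
      l.head.asIdeal = P → l.length ≤ D) : ChainBound 𝔟 D := by
  intro l hl
  obtain ⟨P, hP, hPl⟩ := Ideal.exists_minimalPrimes_le (hab.trans hl)
  by_cases he : P = l.head.asIdeal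
  · exact hmin P hP (he ▸ hl) l he.symm
  · let p : PrimeSpectrum R := ⟨P, hP.1.1⟩
    have hp : p < l.head := lt_of_le_of_ne hPl fun h => he (congrArg PrimeSpectrum.asIdeal h)
    have := h (l.cons p hp) (by simpa using hP.1.2)
    simpa using this

end Dimension

lemma Submodule.exists_mem_forall_notMem_of_infinite {k V : Type*} [Field k] [Infinite k]
    [AddCommGroup V] [Module k V] (W : Submodule k V) (S : Set (Submodule k V)) (hS : S.Finite)
    (h : ∀ P ∈ S, ¬ W ≤ P) : ∃ v ∈ W, ∀ P ∈ S, v ∉ P := by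
  classical
  have key := Subspace.biUnion_ne_univ_of_top_notMem (k := k) (E := W)
    (s := hS.toFinset.image fun P => P.comap W.subtype) (by
      simp only [Finset.mem_image, Set.Finite.mem_toFinset, not_exists, not_and]
      intro P hP he
      refine h P hP fun v hv => ?_
      have : (⟨v, hv⟩ : W) ∈ P.comap W.subtype := he ▸ Submodule.mem_top
      exact this)
  obtain ⟨v, hv⟩ := (Set.ne_univ_iff_exists_notMem _).mp key
  refine ⟨v, v.2, fun P hP hvP => hv ?_⟩
  simp only [Finset.mem_image, Set.mem_iUnion]
  exact ⟨P.comap W.subtype, ⟨P, by simpa using hP, rfl⟩, hvP⟩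

section Graded

open DirectSum

variable {k M : Type*} [Field k] [AddCommGroup M] [Module k M]
  (ℳ : ℕ → Submodule k M) [Decomposition ℳ]

/-- The projection onto the component of degree `j`. -/
def gradedProj (j : ℕ) : M →ₗ[k] M :=
  (ℳ j).subtype ∘ₗ DirectSum.component k ℕ (fun i => ℳ i) j ∘ₗ
    (decomposeLinearEquiv ℳ).toLinearMap

lemma gradedProj_mem (j : ℕ) (x : M) : gradedProj ℳ j x ∈ ℳ j := (decompose ℳ x j).2

lemma gradedProj_of_mem {j : ℕ} {x : M} (hx : x ∈ ℳ j) : gradedProj ℳ j x = x :=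
  decompose_of_mem_same ℳ hx

lemma gradedProj_of_mem_ne {i j : ℕ} {x : M} (hx : x ∈ ℳ i) (h : i ≠ j) :
    gradedProj ℳ j x = 0 :=
  decompose_of_mem_ne ℳ hx h

lemma exists_sum_gradedProj (x : M) : ∃ s : Finset ℕ, x = ∑ j ∈ s, gradedProj ℳ j x := by
  classical
  exact ⟨_, (sum_support_decompose ℳ x).symm⟩

lemma iSup_graded_eq_top : ⨆ j, ℳ j = ⊤ := by
  refine eq_top_iff.mpr fun x _ => ?_
  obtain ⟨s, hs⟩ := exists_sum_gradedProj ℳ x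
  rw [hs]
  exact Submodule.sum_mem _ fun j _ => Submodule.mem_iSup_of_mem j (gradedProj_mem ℳ j x)

/-- A homogeneous element of the span of homogeneous elements lies in the span of those of
its own degree. -/
lemma mem_span_inter_of_mem_span {T : Set M} (hT : ∀ t ∈ T, ∃ i, t ∈ ℳ i) {j : ℕ} {z : M}
    (hz : z ∈ Submodule.span k T) (hzj : z ∈ ℳ j) :
    z ∈ Submodule.span k (T ∩ ℳ j) := by
  have h : Submodule.span k T ≤ (Submodule.span k (T ∩ ℳ j)).comap (gradedProj ℳ j) := by
    refine Submodule.span_le.mpr fun t ht => ?_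
    obtain ⟨i, hi⟩ := hT t ht
    change gradedProj ℳ j t ∈ Submodule.span k (T ∩ ℳ j)
    by_cases hij : i = j
    · subst hij
      rw [gradedProj_of_mem ℳ hi]
      exact Submodule.subset_span ⟨ht, hi⟩
    · rw [gradedProj_of_mem_ne ℳ hi hij]
      exact Submodule.zero_mem _
  have := h hz
  rwa [Submodule.mem_comap, gradedProj_of_mem ℳ hzj] at this

/-- Sums of graded components over disjoint sets of degrees are disjoint. -/
lemma disjoint_iSup_graded {S T : Set ℕ} (hST : Disjoint S T) :
    Disjoint (⨆ j ∈ S, ℳ j) (⨆ j ∈ T, ℳ j) := by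
  rw [Submodule.disjoint_def]
  intro x hS hT
  obtain ⟨s, hs⟩ := exists_sum_gradedProj ℳ x
  have key : ∀ (U : Set ℕ) (j : ℕ), j ∉ U → (⨆ i ∈ U, ℳ i) ≤ LinearMap.ker (gradedProj ℳ j) :=
    by
    intro U j hj
    refine iSup₂_le fun i hi y hy => ?_
    exact gradedProj_of_mem_ne ℳ hy fun h => hj (h ▸ hi)
  rw [hs]
  refine Finset.sum_eq_zero fun j _ => ?_
  by_cases hj : j ∈ S
  · exact key T j (Set.disjoint_left.mp hST hj) hT
  · exact key S j hj hS

variable {R : Type*} [CommRing R] [Algebra k R] (𝒜 : ℕ → Submodule k R)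
  [Module R M] [SetLike.GradedSMul 𝒜 ℳ]

omit [Decomposition ℳ] in
lemma smul_mem_graded {i j : ℕ} {a : R} {x : M} (ha : a ∈ 𝒜 i) (hx : x ∈ ℳ j) :
    a • x ∈ ℳ (i + j) := SetLike.GradedSMul.smul_mem ha hx

lemma gradedProj_smul {i : ℕ} {a : R} (ha : a ∈ 𝒜 i) (j : ℕ) (x : M) :
    gradedProj ℳ (i + j) (a • x) = a • gradedProj ℳ j x := by
  have hx : x ∈ ⨆ j, ℳ j := iSup_graded_eq_top ℳ ▸ Submodule.mem_top
  induction hx using Submodule.iSup_induction' with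
  | mem l x hx =>
    by_cases h : l = j
    · subst h
      rw [gradedProj_of_mem ℳ hx, gradedProj_of_mem ℳ (smul_mem_graded ℳ 𝒜 ha hx)]
    · rw [gradedProj_of_mem_ne ℳ hx h, smul_zero,
        gradedProj_of_mem_ne ℳ (smul_mem_graded ℳ 𝒜 ha hx) (by omega)]
  | zero => simp
  | add x y _ _ hx hy => simp [smul_add, hx, hy]

lemma gradedProj_smul_of_lt {i : ℕ} {a : R} (ha : a ∈ 𝒜 i) {n : ℕ} (hn : n < i) (x : M) :
    gradedProj ℳ n (a • x) = 0 := by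
  have hx : x ∈ ⨆ j, ℳ j := iSup_graded_eq_top ℳ ▸ Submodule.mem_top
  induction hx using Submodule.iSup_induction' with
  | mem l x hx => exact gradedProj_of_mem_ne ℳ (smul_mem_graded ℳ 𝒜 ha hx) (by omega)
  | zero => simp
  | add x y _ _ hx hy => simp [smul_add, hx, hy]

variable [IsScalarTower k R M]

/-- The dimension of the degree `m` component of `L/N`, for `N ≤ L`. -/
noncomputable def quotientHilbert (N L : Submodule R M) (m : ℕ) : ℕ :=
  Module.finrank k
    ((L.restrictScalars k ⊓ ℳ m).map (N.mkQ.restrictScalars k))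

end Graded

section Generation

open DirectSum

variable {k R M : Type*} [Field k] [CommRing R] [Algebra k R] (𝒜 : ℕ → Submodule k R)
  [GradedAlgebra 𝒜]

omit [GradedAlgebra 𝒜] in
/-- In a standard graded algebra, `𝒜 n` lies in the `n`-th power of the ideal generated by
the linear forms. -/
lemma graded_le_pow_span_one
    (hstd : ∀ m : ℕ, (𝒜 (m + 1) : Set R) ⊆
      Submodule.span k (Set.image2 (· * ·) (𝒜 1 : Set R) (𝒜 m : Set R)))
    (n : ℕ) {a : R} (ha : a ∈ 𝒜 n) : a ∈ Ideal.span (𝒜 1 : Set R) ^ n := by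
  induction n generalizing a with
  | zero => simp
  | succ n ih =>
    have h : Submodule.span k (Set.image2 (· * ·) (𝒜 1 : Set R) (𝒜 n : Set R)) ≤
        (Ideal.span (𝒜 1 : Set R) ^ (n + 1)).restrictScalars k := by
      refine Submodule.span_le.mpr ?_
      rintro _ ⟨x, hx, y, hy, rfl⟩
      change x * y ∈ _
      rw [pow_succ']
      exact Ideal.mul_mem_mul (Ideal.subset_span hx) (ih hy)
    exact h (hstd n ha)

variable [AddCommGroup M] [Module R M] [Module k M]
  (ℳ : ℕ → Submodule k M) [SetLike.GradedSMul 𝒜 ℳ] [Decomposition ℳ]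

omit [GradedAlgebra 𝒜] in
lemma gradedProj_of_mem_pow_smul {n j : ℕ} (hj : j < n) {x : M}
    (hx : x ∈ Ideal.span (𝒜 1 : Set R) ^ n • (⊤ : Submodule R M)) : gradedProj ℳ j x = 0 := by
  induction n generalizing j x with
  | zero => omega
  | succ n ih =>
    rw [pow_succ', Submodule.mul_smul] at hx
    refine Submodule.smul_induction_on hx (fun r hr x hx => ?_)
      (fun x y hx hy => by rw [map_add, hx, hy, add_zero])
    induction hr using Submodule.closure_induction with
    | zero => simp
    | add r s _ _ hr hs => rw [add_smul, map_add, hr, hs, add_zero]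
    | smul_mem c a ha =>
      rw [smul_eq_mul, mul_comm, mul_smul]
      rcases j with _ | j
      · exact gradedProj_smul_of_lt ℳ 𝒜 ha zero_lt_one _
      · rw [add_comm, gradedProj_smul ℳ 𝒜 ha, ih (by omega) (Submodule.smul_mem _ c hx),
          smul_zero]

/-- A span over `R` of homogeneous elements is the `k`-span of homogeneous multiples. -/
lemma mem_span_homogeneous_smul {G : Set M} {x : M} (hx : x ∈ Submodule.span R G) :
    x ∈ Submodule.span k {t : M | ∃ i, ∃ a ∈ 𝒜 i, ∃ g ∈ G, t = a • g} := by
  set T := Submodule.span k {t : M | ∃ i, ∃ a ∈ 𝒜 i, ∃ g ∈ G, t = a • g}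
  induction hx using Submodule.closure_induction with
  | zero => exact T.zero_mem
  | add x y _ _ hx hy => exact T.add_mem hx hy
  | smul_mem r x hx =>
    obtain ⟨s, hs⟩ := exists_sum_gradedProj 𝒜 r
    rw [hs, Finset.sum_smul]
    exact T.sum_mem fun j _ => Submodule.subset_span ⟨j, _, gradedProj_mem 𝒜 j r, x, hx, rfl⟩

/-- A homogeneous element of a submodule spanned by homogeneous elements is a `k`-combination
of homogeneous multiples of the right degree. -/
lemma mem_span_homogeneous_smul_of_mem {G : Set M} (hG : ∀ g ∈ G, ∃ l, g ∈ ℳ l) {j : ℕ} {x : M}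
    (hx : x ∈ Submodule.span R G) (hxj : x ∈ ℳ j) :
    x ∈ Submodule.span k {t : M | ∃ i l, i + l = j ∧ ∃ a ∈ 𝒜 i, ∃ g ∈ G, g ∈ ℳ l ∧ t = a • g} := by
  have h := mem_span_inter_of_mem_span ℳ (fun t ht => ?_) (mem_span_homogeneous_smul 𝒜 hx) hxj
  · refine Submodule.span_le.mpr ?_ h
    rintro _ ⟨⟨i, a, ha, g, hg, rfl⟩, htj⟩
    obtain ⟨l, hl⟩ := hG g hg
    by_cases hij : i + l = j
    · exact Submodule.subset_span ⟨i, l, hij, a, ha, g, hg, hl, rfl⟩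
    · have h1 := gradedProj_of_mem_ne ℳ (smul_mem_graded ℳ 𝒜 ha hl) hij
      rw [gradedProj_of_mem ℳ htj] at h1
      rw [h1]
      exact Submodule.zero_mem _
  · obtain ⟨i, a, ha, g, hg, rfl⟩ := ht
    obtain ⟨l, hl⟩ := hG g hg
    exact ⟨i + l, smul_mem_graded ℳ 𝒜 ha hl⟩

omit [Algebra k R] in
lemma exists_eq_span_homogeneous [IsNoetherian R M] {L : Submodule R M} (hL : L.IsHomogeneous ℳ) :
    ∃ δ : ℕ, L = Submodule.span R {g : M | g ∈ L ∧ ∃ l ≤ δ, g ∈ ℳ l} := by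
  let F : ℕ →o Submodule R M :=
    ⟨fun δ => Submodule.span R {g : M | g ∈ L ∧ ∃ l ≤ δ, g ∈ ℳ l}, fun a b hab =>
      Submodule.span_mono fun g ⟨hg, l, hl, hgl⟩ => ⟨hg, l, hl.trans hab, hgl⟩⟩
  obtain ⟨n, hn⟩ := monotone_stabilizes_iff_noetherian.mpr ‹IsNoetherian R M› F
  refine ⟨n, le_antisymm (fun x hx => ?_) (Submodule.span_le.mpr fun g hg => hg.1)⟩
  obtain ⟨s, hs⟩ := exists_sum_gradedProj ℳ x
  rw [hs]
  refine Submodule.sum_mem _ fun j _ => ?_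
  change _ ∈ F n
  rw [hn (max n j) (le_max_left _ _)]
  exact Submodule.subset_span ⟨hL j hx, j, le_max_right _ _, gradedProj_mem ℳ j x⟩

variable [IsScalarTower k R M] in
/-- Elements of large degree of a homogeneous submodule lie in a large power of the ideal
generated by the linear forms, times the submodule. -/
lemma exists_mem_pow_smul_of_degree_ge [IsNoetherian R M]
    (hstd : ∀ m : ℕ, (𝒜 (m + 1) : Set R) ⊆
      Submodule.span k (Set.image2 (· * ·) (𝒜 1 : Set R) (𝒜 m : Set R)))
    {L : Submodule R M} (hL : L.IsHomogeneous ℳ) :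
    ∃ δ : ℕ, ∀ n j, δ + n ≤ j → ∀ x ∈ L, x ∈ ℳ j →
      x ∈ Ideal.span (𝒜 1 : Set R) ^ n • L := by
  obtain ⟨δ, hδ⟩ := exists_eq_span_homogeneous (R := R) ℳ hL
  refine ⟨δ, fun n j hj x hx hxj => ?_⟩
  rw [hδ] at hx
  have h := mem_span_homogeneous_smul_of_mem 𝒜 ℳ (fun g hg => ?_) hx hxj
  · refine (Submodule.span_le (p := (Ideal.span (𝒜 1 : Set R) ^ n • L).restrictScalars k)).mpr
      ?_ h
    rintro _ ⟨i, l, hil, a, ha, g, ⟨hgL, l', hl', hgl'⟩, hgl, rfl⟩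
    change a • g ∈ Ideal.span (𝒜 1 : Set R) ^ n • L
    by_cases h0 : l' = l
    · refine Submodule.smul_mem_smul ?_ hgL
      exact Ideal.pow_le_pow_right (by omega) (graded_le_pow_span_one 𝒜 hstd i ha)
    · have h1 := gradedProj_of_mem_ne ℳ hgl' h0
      rw [gradedProj_of_mem ℳ hgl] at h1
      rw [h1, smul_zero]
      exact Submodule.zero_mem _
  · exact ⟨_, hg.2.choose_spec.2⟩

end Generation

/-- The dimension of a subspace is at most that of its image plus that of any subspace
containing the kernel. -/
lemma Submodule.finrank_le_finrank_map_add {k V W : Type*} [Field k] [AddCommGroup V]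
    [Module k V] [AddCommGroup W] [Module k W] (X Y : Submodule k V) [FiniteDimensional k X]
    [FiniteDimensional k Y] (f : V →ₗ[k] W) (h : ∀ x ∈ X, f x = 0 → x ∈ Y) :
    Module.finrank k X ≤ Module.finrank k (X.map f) + Module.finrank k Y := by
  have h1 := (f.domRestrict X).finrank_range_add_finrank_ker
  rw [LinearMap.range_domRestrict] at h1
  have h2 : Module.finrank k (LinearMap.ker (f.domRestrict X)) ≤ Module.finrank k Y := by
    rw [(Submodule.equivMapOfInjective X.subtype X.injective_subtype
      (LinearMap.ker (f.domRestrict X))).finrank_eq]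
    refine Submodule.finrank_mono ?_
    rintro _ ⟨x, hx, rfl⟩
    exact h x x.2 hx
  omega

section Hilbert

open DirectSum

variable {k R M : Type*} [Field k] [CommRing R] [Algebra k R] (𝒜 : ℕ → Submodule k R)
  [GradedAlgebra 𝒜]

/-- A prime containing the linear forms of a standard graded algebra is maximal. -/
lemma Ideal.IsPrime.isMaximal_of_linearForms_le [FiniteDimensional k (𝒜 0)]
    (hstd : ∀ m : ℕ, (𝒜 (m + 1) : Set R) ⊆
      Submodule.span k (Set.image2 (· * ·) (𝒜 1 : Set R) (𝒜 m : Set R)))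
    {P : Ideal R} (hP : P.IsPrime) (h : (𝒜 1 : Set R) ⊆ P) : P.IsMaximal := by
  have hsurj : Function.Surjective
      ((Ideal.Quotient.mkₐ k P).toLinearMap ∘ₗ (𝒜 0).subtype) := by
    intro y
    obtain ⟨x, rfl⟩ := Ideal.Quotient.mk_surjective y
    refine ⟨⟨gradedProj 𝒜 0 x, gradedProj_mem 𝒜 0 x⟩, ?_⟩
    change Ideal.Quotient.mk P (gradedProj 𝒜 0 x) = Ideal.Quotient.mk P x
    obtain ⟨s, hs⟩ := exists_sum_gradedProj 𝒜 x
    have hs' : x = ∑ j ∈ insert 0 s, gradedProj 𝒜 j x := by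
      by_cases h0 : 0 ∈ s
      · rwa [Finset.insert_eq_of_mem h0]
      · have : gradedProj 𝒜 0 x = 0 := by
          rw [hs, map_sum]
          refine Finset.sum_eq_zero fun j hj => gradedProj_of_mem_ne 𝒜 (gradedProj_mem 𝒜 j x) ?_
          rintro rfl
          exact h0 hj
        rw [Finset.sum_insert h0, this, zero_add]
        exact hs
    conv_rhs => rw [hs', map_sum]
    rw [Finset.sum_eq_single 0]
    · intro j _ hj
      refine Ideal.Quotient.eq_zero_iff_mem.mpr ?_
      have h1 := graded_le_pow_span_one 𝒜 hstd j (gradedProj_mem 𝒜 j x)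
      exact Ideal.span_le.mpr h (Ideal.pow_le_self hj h1)
    · simp
  have hfin : Module.Finite k (R ⧸ P) := Module.Finite.of_surjective _ hsurj
  have : IsArtinianRing (R ⧸ P) := IsArtinianRing.of_finite k _
  exact Ideal.Quotient.maximal_of_isField _ (IsArtinianRing.isField_of_isDomain _)

variable [AddCommGroup M] [Module R M] [Module k M] [IsScalarTower k R M]
  (ℳ : ℕ → Submodule k M) [SetLike.GradedSMul 𝒜 ℳ] [Decomposition ℳ]

/-- A graded module over an Artinian standard graded algebra vanishes in large degrees. -/
lemma exists_forall_mem_of_degree_ge [IsNoetherian R M]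
    (hstd : ∀ m : ℕ, (𝒜 (m + 1) : Set R) ⊆
      Submodule.span k (Set.image2 (· * ·) (𝒜 1 : Set R) (𝒜 m : Set R)))
    (𝔞 : Ideal R) [IsArtinianRing (R ⧸ 𝔞)] {N L : Submodule R M} (hN : N.IsHomogeneous ℳ)
    (hL : L.IsHomogeneous ℳ) (h : 𝔞 • L ≤ N) :
    ∃ n, ∀ j, n ≤ j → ∀ x ∈ L, x ∈ ℳ j → x ∈ N := by
  set 𝔪 := Ideal.span (𝒜 1 : Set R)
  let π := Ideal.Quotient.mk 𝔞
  let F : ℕ →o (Ideal (R ⧸ 𝔞))ᵒᵈ := ⟨fun n => OrderDual.toDual ((𝔪 ^ n).map π),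
    fun a b hab => Ideal.map_mono (Ideal.pow_le_pow_right hab)⟩
  obtain ⟨n, hn⟩ := IsArtinian.monotone_stabilizes F
  have hpow : ∀ s, n ≤ s → 𝔪 ^ n ≤ 𝔪 ^ s ⊔ 𝔞 := by
    intro s hs
    have h1 : (𝔪 ^ n).map π = (𝔪 ^ s).map π := congrArg OrderDual.ofDual (hn s hs)
    have h2 := Ideal.le_comap_map (f := π) (I := 𝔪 ^ n)
    rw [h1, Ideal.comap_map_of_surjective π Ideal.Quotient.mk_surjective] at h2
    refine h2.trans (sup_le_sup_left (fun x hx => ?_) _)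
    exact Ideal.Quotient.eq_zero_iff_mem.mp (by simpa using hx)
  obtain ⟨δ, hδ⟩ := exists_mem_pow_smul_of_degree_ge 𝒜 ℳ hstd hL
  refine ⟨δ + n, fun j hj x hx hxj => ?_⟩
  have h1 := Submodule.smul_mono_left (N := L) (hpow (n + j + 1) (by omega)) (hδ n j hj x hx hxj)
  rw [Submodule.sup_smul] at h1
  obtain ⟨y, hy, z, hz, hyz⟩ := Submodule.mem_sup.mp h1
  have hy' := gradedProj_of_mem_pow_smul 𝒜 ℳ (n := n + j + 1) (j := j) (by omega)
    (Submodule.smul_mono le_rfl le_top hy)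
  have h2 : gradedProj ℳ j x ∈ N := by
    rw [← hyz, map_add, hy', zero_add]
    exact hN j (h hz)
  rwa [gradedProj_of_mem ℳ hxj] at h2

variable {ℳ} in
omit [IsScalarTower k R M] [Algebra k R] in
lemma Submodule.IsHomogeneous.sup {N N' : Submodule R M} (h : N.IsHomogeneous ℳ)
    (h' : N'.IsHomogeneous ℳ) : (N ⊔ N').IsHomogeneous ℳ := by
  intro j x hx
  obtain ⟨y, hy, z, hz, rfl⟩ := Submodule.mem_sup.mp hx
  change gradedProj ℳ j (y + z) ∈ N ⊔ N'
  rw [map_add]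
  exact Submodule.add_mem_sup (h j hy) (h' j hz)

variable {ℳ} in
omit [IsScalarTower k R M] [GradedAlgebra 𝒜] in
lemma Submodule.IsHomogeneous.map_lsmul {L : Submodule R M} (h : L.IsHomogeneous ℳ) {i : ℕ}
    {u : R} (hu : u ∈ 𝒜 i) : (L.map (LinearMap.lsmul R M u)).IsHomogeneous ℳ := by
  rintro j _ ⟨y, hy, rfl⟩
  change gradedProj ℳ j (u • y) ∈ _
  by_cases hj : i ≤ j
  · obtain ⟨j, rfl⟩ := Nat.exists_eq_add_of_le hj
    rw [gradedProj_smul ℳ 𝒜 hu]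
    exact ⟨_, h j hy, rfl⟩
  · rw [gradedProj_smul_of_lt ℳ 𝒜 hu (not_le.mp hj)]
    exact Submodule.zero_mem _

variable [∀ m, FiniteDimensional k (ℳ m)]

omit [GradedAlgebra 𝒜] in
lemma quotientHilbert_succ_le {N L : Submodule R M} (hN : N.IsHomogeneous ℳ)
    (hL : L.IsHomogeneous ℳ) {u : R} (hu : u ∈ 𝒜 1) (m : ℕ) :
    quotientHilbert ℳ N L (m + 1) ≤
      quotientHilbert ℳ (N ⊔ L.map (LinearMap.lsmul R M u)) L (m + 1) +
        quotientHilbert ℳ N L m := by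
  set N' := N ⊔ L.map (LinearMap.lsmul R M u) with hN'
  have hle : N ≤ N' := le_sup_left
  let f : (M ⧸ N) →ₗ[k] (M ⧸ N') := (Submodule.factor hle).restrictScalars k
  let X := (L.restrictScalars k ⊓ ℳ (m + 1)).map (N.mkQ.restrictScalars k)
  let Z := (L.restrictScalars k ⊓ ℳ m).map (N.mkQ.restrictScalars k)
  let Y := Z.map ((LinearMap.lsmul R (M ⧸ N) u).restrictScalars k)
  have key := Submodule.finrank_le_finrank_map_add X Y f ?_
  · have h1 : X.map f = (L.restrictScalars k ⊓ ℳ (m + 1)).map (N'.mkQ.restrictScalars k) := by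
      rw [← Submodule.map_comp]
      rfl
    rw [h1] at key
    exact key.trans (Nat.add_le_add_left
      (Submodule.finrank_map_le ((LinearMap.lsmul R (M ⧸ N) u).restrictScalars k) Z) _)
  · rintro _ ⟨x, ⟨hxL, hxm⟩, rfl⟩ hx
    have hx' : x ∈ N' := (Submodule.Quotient.mk_eq_zero N').mp hx
    obtain ⟨n, hn, _, ⟨l, hl, rfl⟩, hnl⟩ := Submodule.mem_sup.mp hx'
    refine ⟨N.mkQ (gradedProj ℳ m l), ⟨_, ⟨hL m hl, gradedProj_mem ℳ m l⟩, rfl⟩, ?_⟩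
    have h2 : x = gradedProj ℳ (m + 1) n + u • gradedProj ℳ m l := by
      have h3 := gradedProj_smul ℳ 𝒜 hu m l
      rw [← h3, add_comm 1 m, ← gradedProj_of_mem ℳ hxm, ← hnl, map_add]
      rfl
    change u • N.mkQ (gradedProj ℳ m l) = N.mkQ x
    have h4 : N.mkQ (gradedProj ℳ (m + 1) n) = 0 :=
      (Submodule.Quotient.mk_eq_zero N).mpr (hN (m + 1) hn)
    rw [h2, map_add, map_smul, h4, zero_add]

omit [GradedAlgebra 𝒜] in
lemma quotientHilbert_zero_le {N L : Submodule R M} (hN : N.IsHomogeneous ℳ)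
    {u : R} (hu : u ∈ 𝒜 1) :
    quotientHilbert ℳ N L 0 ≤ quotientHilbert ℳ (N ⊔ L.map (LinearMap.lsmul R M u)) L 0 := by
  set N' := N ⊔ L.map (LinearMap.lsmul R M u) with hN'
  have hle : N ≤ N' := le_sup_left
  let f : (M ⧸ N) →ₗ[k] (M ⧸ N') := (Submodule.factor hle).restrictScalars k
  let X := (L.restrictScalars k ⊓ ℳ 0).map (N.mkQ.restrictScalars k)
  have key := Submodule.finrank_le_finrank_map_add X ⊥ f ?_
  · have h1 : X.map f = (L.restrictScalars k ⊓ ℳ 0).map (N'.mkQ.restrictScalars k) := by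
      rw [← Submodule.map_comp]
      rfl
    rw [h1, finrank_bot, add_zero] at key
    exact key
  · rintro _ ⟨x, ⟨hxL, hxm⟩, rfl⟩ hx
    have hx' : x ∈ N' := (Submodule.Quotient.mk_eq_zero N').mp hx
    obtain ⟨n, hn, _, ⟨l, hl, rfl⟩, hnl⟩ := Submodule.mem_sup.mp hx'
    have h2 : x = gradedProj ℳ 0 n := by
      rw [← gradedProj_of_mem ℳ hxm, ← hnl, map_add, LinearMap.lsmul_apply,
        gradedProj_smul_of_lt ℳ 𝒜 hu zero_lt_one, add_zero]
    refine (Submodule.mem_bot k).mpr ((Submodule.Quotient.mk_eq_zero N).mpr ?_)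
    rw [h2]
    exact hN 0 hn

omit [GradedAlgebra 𝒜] in
lemma quotientHilbert_le_sum {N L : Submodule R M} (hN : N.IsHomogeneous ℳ)
    (hL : L.IsHomogeneous ℳ) {u : R} (hu : u ∈ 𝒜 1) (m : ℕ) :
    quotientHilbert ℳ N L m ≤ ∑ j ∈ Finset.range (m + 1),
      quotientHilbert ℳ (N ⊔ L.map (LinearMap.lsmul R M u)) L j := by
  induction m with
  | zero => simpa using quotientHilbert_zero_le 𝒜 ℳ hN hu
  | succ m ih =>
    rw [Finset.sum_range_succ]
    have := quotientHilbert_succ_le 𝒜 ℳ hN hL hu m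
    omega

/-- A linear form cutting the dimension down by one. -/
lemma exists_linearForm_chainBound [Infinite k] [IsNoetherianRing R] [FiniteDimensional k (𝒜 0)]
    (hstd : ∀ m : ℕ, (𝒜 (m + 1) : Set R) ⊆
      Submodule.span k (Set.image2 (· * ·) (𝒜 1 : Set R) (𝒜 m : Set R)))
    {𝔞 : Ideal R} {D : ℕ} (h : ChainBound 𝔞 (D + 1)) :
    ∃ u ∈ 𝒜 1, ChainBound (𝔞 ⊔ Ideal.span {u}) D := by
  obtain ⟨u, hu, hu'⟩ := Submodule.exists_mem_forall_notMem_of_infinite (𝒜 1)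
    ((fun P : Ideal R => P.restrictScalars k) '' {P ∈ 𝔞.minimalPrimes | ¬ (𝒜 1 : Set R) ⊆ P})
    ((𝔞.finite_minimalPrimes_of_isNoetherianRing R |>.subset (Set.sep_subset _ _)).image _)
    (by rintro _ ⟨P, ⟨_, hP⟩, rfl⟩ h; exact hP h)
  refine ⟨u, hu, h.of_minimalPrimes le_sup_left fun P hP hle l hl => ?_⟩
  have huP : u ∈ P := hle (Submodule.mem_sup_right (Ideal.mem_span_singleton_self u))
  have hAP : (𝒜 1 : Set R) ⊆ P := by
    by_contra hcon
    exact hu' _ ⟨P, ⟨hP, hcon⟩, rfl⟩ huP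
  have hmax := hP.1.1.isMaximal_of_linearForms_le 𝒜 hstd hAP
  rw [l.length_eq_zero_of_isMaximal_head (hl ▸ hmax)]
  exact Nat.zero_le D

omit [IsScalarTower k R M] [Decomposition ℳ] [∀ m, FiniteDimensional k (ℳ m)]
  [SetLike.GradedSMul 𝒜 ℳ] [GradedAlgebra 𝒜] [Module k M] [Algebra k R] [Field k] in
lemma sup_span_singleton_smul_le {𝔞 : Ideal R} {N L : Submodule R M} (h : 𝔞 • L ≤ N) (u : R) :
    (𝔞 ⊔ Ideal.span {u}) • L ≤ N ⊔ L.map (LinearMap.lsmul R M u) := by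
  rw [Submodule.sup_smul]
  refine sup_le_sup h (Submodule.smul_le.mpr fun r hr x hx => ?_)
  obtain ⟨c, rfl⟩ := Ideal.mem_span_singleton'.mp hr
  rw [mul_smul]
  exact Submodule.smul_mem _ c ⟨x, hx, rfl⟩

/-- The cumulative Hilbert function of a graded module of dimension at most `D` grows at most
like a polynomial of degree `D`. -/
lemma exists_sum_quotientHilbert_le [Infinite k] [IsNoetherianRing R] [IsNoetherian R M]
    [FiniteDimensional k (𝒜 0)]
    (hstd : ∀ m : ℕ, (𝒜 (m + 1) : Set R) ⊆
      Submodule.span k (Set.image2 (· * ·) (𝒜 1 : Set R) (𝒜 m : Set R)))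
    (D : ℕ) {𝔞 : Ideal R} (h : ChainBound 𝔞 D) {N L : Submodule R M}
    (hN : N.IsHomogeneous ℳ) (hL : L.IsHomogeneous ℳ) (hNL : 𝔞 • L ≤ N) :
    ∃ C : ℕ, ∀ m, ∑ j ∈ Finset.range (m + 1), quotientHilbert ℳ N L j ≤ C * (m + 1) ^ D := by
  induction D generalizing 𝔞 N with
  | zero =>
    have := h.isArtinianRing_quotient
    obtain ⟨n, hn⟩ := exists_forall_mem_of_degree_ge 𝒜 ℳ hstd 𝔞 hN hL hNL
    refine ⟨∑ j ∈ Finset.range n, quotientHilbert ℳ N L j, fun m => ?_⟩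
    rw [pow_zero, mul_one]
    refine Finset.sum_le_sum_of_ne_zero fun j _ hj => Finset.mem_range.mpr ?_
    by_contra hjn
    refine hj ?_
    have h0 : (L.restrictScalars k ⊓ ℳ j).map (N.mkQ.restrictScalars k) = ⊥ := by
      refine eq_bot_iff.mpr ?_
      rintro _ ⟨x, hx, rfl⟩
      exact (Submodule.mem_bot k).mpr
        ((Submodule.Quotient.mk_eq_zero N).mpr (hn j (not_lt.mp hjn) x hx.1 hx.2))
    rw [quotientHilbert, h0, finrank_bot]
  | succ D ih =>
    obtain ⟨u, hu, hD⟩ := exists_linearForm_chainBound 𝒜 hstd h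
    obtain ⟨C, hC⟩ := ih hD (hN.sup (hL.map_lsmul 𝒜 hu)) (sup_span_singleton_smul_le hNL u)
    refine ⟨C, fun m => ?_⟩
    calc ∑ j ∈ Finset.range (m + 1), quotientHilbert ℳ N L j
        ≤ ∑ j ∈ Finset.range (m + 1), C * (m + 1) ^ D := by
          refine Finset.sum_le_sum fun j hj => ?_
          refine (quotientHilbert_le_sum 𝒜 ℳ hN hL hu j).trans ((hC j).trans ?_)
          have := Finset.mem_range.mp hj
          gcongr
          omega
      _ = C * (m + 1) ^ (D + 1) := by
          rw [Finset.sum_const, Finset.card_range, smul_eq_mul]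
          ring

/-- The Hilbert function of a graded module of dimension at most `D + 1` grows at most like a
polynomial of degree `D`. -/
lemma exists_quotientHilbert_le [Infinite k] [IsNoetherianRing R] [IsNoetherian R M]
    [FiniteDimensional k (𝒜 0)]
    (hstd : ∀ m : ℕ, (𝒜 (m + 1) : Set R) ⊆
      Submodule.span k (Set.image2 (· * ·) (𝒜 1 : Set R) (𝒜 m : Set R)))
    {D : ℕ} {𝔞 : Ideal R} (h : ChainBound 𝔞 (D + 1)) {N L : Submodule R M}
    (hN : N.IsHomogeneous ℳ) (hL : L.IsHomogeneous ℳ) (hNL : 𝔞 • L ≤ N) :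
    ∃ C : ℕ, ∀ m, quotientHilbert ℳ N L m ≤ C * (m + 1) ^ D := by
  obtain ⟨u, hu, hD⟩ := exists_linearForm_chainBound 𝒜 hstd h
  obtain ⟨C, hC⟩ := exists_sum_quotientHilbert_le 𝒜 ℳ hstd D hD
    (hN.sup (hL.map_lsmul 𝒜 hu)) hL (sup_span_singleton_smul_le hNL u)
  exact ⟨C, fun m => (quotientHilbert_le_sum 𝒜 ℳ hN hL hu m).trans (hC m)⟩

end Hilbert

section Annihilator

open DirectSum

variable {k R M : Type*} [Field k] [CommRing R] [Algebra k R] (𝒜 : ℕ → Submodule k R)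
  [GradedAlgebra 𝒜]

section Colon

variable [AddCommGroup M] [Module R M] [Module k M] (ℳ : ℕ → Submodule k M)
  [SetLike.GradedSMul 𝒜 ℳ] [Decomposition ℳ]

lemma gradedProj_smul_of_mem (r : R) {i : ℕ} {x : M} (hx : x ∈ ℳ i) (j : ℕ) :
    gradedProj ℳ (j + i) (r • x) = gradedProj 𝒜 j r • x := by
  have hr : r ∈ ⨆ j, 𝒜 j := iSup_graded_eq_top 𝒜 ▸ Submodule.mem_top
  induction hr using Submodule.iSup_induction' with
  | mem l r hr =>
    by_cases h : l = j
    · subst h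
      rw [gradedProj_of_mem 𝒜 hr, gradedProj_of_mem ℳ (smul_mem_graded ℳ 𝒜 hr hx)]
    · rw [gradedProj_of_mem_ne 𝒜 hr h, zero_smul,
        gradedProj_of_mem_ne ℳ (smul_mem_graded ℳ 𝒜 hr hx) (by omega)]
  | zero => simp
  | add r s _ _ hr hs => simp [add_smul, hr, hs]

variable {ℳ} in
lemma gradedProj_smul_mem_of_forall_smul_mem {N L : Submodule R M} (hN : N.IsHomogeneous ℳ)
    (hL : L.IsHomogeneous ℳ) {r : R} (h : ∀ x ∈ L, r • x ∈ N) (j : ℕ) :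
    ∀ x ∈ L, gradedProj 𝒜 j r • x ∈ N := by
  intro x hx
  obtain ⟨s, hs⟩ := exists_sum_gradedProj ℳ x
  rw [hs, Finset.smul_sum]
  refine Submodule.sum_mem _ fun i _ => ?_
  rw [← gradedProj_smul_of_mem 𝒜 ℳ r (gradedProj_mem ℳ i x)]
  exact hN (j + i) (h _ (hL i hx))

end Colon

/-- A homogeneous ideal cutting the dimension down contains a homogeneous element doing so. -/
lemma exists_homogeneous_chainBound [Infinite k] [IsNoetherianRing R] [FiniteDimensional k (𝒜 0)]
    (hstd : ∀ m : ℕ, (𝒜 (m + 1) : Set R) ⊆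
      Submodule.span k (Set.image2 (· * ·) (𝒜 1 : Set R) (𝒜 m : Set R)))
    {D : ℕ} {𝔞 : Ideal R} (h𝔞 : ∀ j, ∀ r ∈ 𝔞, gradedProj 𝒜 j r ∈ 𝔞)
    (hR : ChainBound (⊥ : Ideal R) (D + 1)) (h : ChainBound 𝔞 D) :
    ∃ e, ∃ a ∈ 𝒜 e, a ∈ 𝔞 ∧ ChainBound (Ideal.span {a}) D := by
  set 𝒬 := {P ∈ (⊥ : Ideal R).minimalPrimes | ¬ (𝒜 1 : Set R) ⊆ P ∧ ¬ 𝔞 ≤ P}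
  have hfin : 𝒬.Finite := (⊥ : Ideal R).finite_minimalPrimes_of_isNoetherianRing R |>.subset
    (Set.sep_subset _ _)
  have hex : ∀ P ∈ 𝒬, ∃ n, ∀ j, n ≤ j → ∃ g ∈ 𝔞, g ∈ 𝒜 j ∧ g ∉ P := by
    rintro P ⟨hP, h1, h2⟩
    obtain ⟨x, hx, hxP⟩ := Set.not_subset.mp h1
    obtain ⟨r, hr, hrP⟩ := Set.not_subset.mp h2
    obtain ⟨s, hs⟩ := exists_sum_gradedProj 𝒜 r
    obtain ⟨n, hn⟩ : ∃ n, gradedProj 𝒜 n r ∉ P := by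
      by_contra! hcon
      exact hrP (hs ▸ P.sum_mem fun j _ => hcon j)
    refine ⟨n, fun j hj => ⟨x ^ (j - n) * gradedProj 𝒜 n r, 𝔞.mul_mem_left _ (h𝔞 n r hr), ?_, ?_⟩⟩
    · have h3 := SetLike.mul_mem_graded (SetLike.pow_mem_graded (j - n) hx)
        (gradedProj_mem 𝒜 n r)
      convert h3 using 2
      simp only [smul_eq_mul, mul_one]
      omega
    · intro hcon
      rcases hP.1.1.mem_or_mem hcon with h3 | h3
      · exact hxP (hP.1.1.mem_of_pow_mem _ h3)
      · exact hn h3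
  choose! n hn using hex
  set N := hfin.toFinset.sup n
  obtain ⟨a, ha, ha'⟩ := Submodule.exists_mem_forall_notMem_of_infinite
    (𝔞.restrictScalars k ⊓ 𝒜 N) ((fun P : Ideal R => P.restrictScalars k) '' 𝒬)
    (hfin.image _) (by
      rintro _ ⟨P, hP, rfl⟩ hle
      obtain ⟨g, hg, hgN, hgP⟩ := hn P hP N (Finset.le_sup (hfin.mem_toFinset.mpr hP))
      exact hgP (hle ⟨hg, hgN⟩))
  refine ⟨N, a, ha.2, ha.1, hR.of_minimalPrimes bot_le fun P hP hle l hl => ?_⟩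
  have haP : a ∈ P := hle (Ideal.mem_span_singleton_self a)
  by_cases hAP : (𝒜 1 : Set R) ⊆ P
  · have hmax := hP.1.1.isMaximal_of_linearForms_le 𝒜 hstd hAP
    rw [l.length_eq_zero_of_isMaximal_head (hl ▸ hmax)]
    exact Nat.zero_le D
  · refine h l (hl ▸ ?_)
    by_contra hcon
    exact ha' _ ⟨P, ⟨hP, hAP, hcon⟩, rfl⟩ haP

variable {M' M'' : Type*} [AddCommGroup M'] [Module R M'] [Module k M']
  [AddCommGroup M''] [Module R M''] [Module k M'']
  (ℳ' : ℕ → Submodule k M') [Decomposition ℳ'] (ℳ'' : ℕ → Submodule k M'') [Decomposition ℳ'']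

omit [Algebra k R] in
lemma gradedProj_map {ψ : M' →ₗ[R] M''} (hψ : ∀ m : ℕ, ∀ x ∈ ℳ' m, ψ x ∈ ℳ'' m) (j : ℕ)
    (x : M') : gradedProj ℳ'' j (ψ x) = ψ (gradedProj ℳ' j x) := by
  have hx : x ∈ ⨆ j, ℳ' j := iSup_graded_eq_top ℳ' ▸ Submodule.mem_top
  induction hx using Submodule.iSup_induction' with
  | mem l x hx =>
    by_cases h : l = j
    · subst h
      rw [gradedProj_of_mem ℳ' hx, gradedProj_of_mem ℳ'' (hψ l x hx)]
    · rw [gradedProj_of_mem_ne ℳ' hx h, gradedProj_of_mem_ne ℳ'' (hψ l x hx) h, map_zero]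
  | zero => simp
  | add x y _ _ hx hy => simp [hx, hy]

omit [Algebra k R] in
lemma isHomogeneous_ker {ψ : M' →ₗ[R] M''} (hψ : ∀ m : ℕ, ∀ x ∈ ℳ' m, ψ x ∈ ℳ'' m) :
    (LinearMap.ker ψ).IsHomogeneous ℳ' := by
  intro j x hx
  have h := gradedProj_map ℳ' ℳ'' hψ j x
  rw [LinearMap.mem_ker.mp hx, map_zero] at h
  exact LinearMap.mem_ker.mpr h.symm

omit [Algebra k R] in
lemma isHomogeneous_range {ψ : M' →ₗ[R] M''} (hψ : ∀ m : ℕ, ∀ x ∈ ℳ' m, ψ x ∈ ℳ'' m) :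
    (LinearMap.range ψ).IsHomogeneous ℳ'' := by
  rintro j _ ⟨x, rfl⟩
  exact ⟨_, (gradedProj_map ℳ' ℳ'' hψ j x).symm⟩

end Annihilator

section Frobenius

variable {R : Type*} [CommRing R]

lemma frobeniusPower_eq_map (p n : ℕ) [ExpChar R p] (I : Ideal R) :
    frobeniusPower I (p ^ n) = I.map (iterateFrobenius R p n) := rfl

lemma frobeniusPower_sup_span_singleton (p n : ℕ) [ExpChar R p] (I : Ideal R) (r : R) :
    frobeniusPower (I ⊔ Ideal.span {r}) (p ^ n) =
      frobeniusPower I (p ^ n) ⊔ Ideal.span {iterateFrobenius R p n r} := by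
  rw [frobeniusPower_eq_map, frobeniusPower_eq_map, Ideal.map_sup, Ideal.map_span,
    Set.image_singleton]

lemma frobeniusPower_span (p n : ℕ) [ExpChar R p] (F : Set R) :
    frobeniusPower (Ideal.span F) (p ^ n) = Ideal.span ((fun f => f ^ p ^ n) '' F) := by
  rw [frobeniusPower_eq_map, Ideal.map_span]
  rfl

variable {M : Type*} [AddCommGroup M] [Module R M]

/-- If `e` is idempotent modulo `J`, then `(J + (e))M ∩ (J + (1 - e))M ⊆ JM`. -/
lemma mem_smul_top_of_idempotent {J : Ideal R} {e : R} (he : e - e ^ 2 ∈ J) {x : M}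
    (h1 : x ∈ (J ⊔ Ideal.span {e}) • (⊤ : Submodule R M))
    (h2 : x ∈ (J ⊔ Ideal.span {1 - e}) • (⊤ : Submodule R M)) :
    x ∈ J • (⊤ : Submodule R M) := by
  have key : ∀ r s : R, s * r ∈ J → x ∈ (J ⊔ Ideal.span {r}) • (⊤ : Submodule R M) →
      s • x ∈ J • (⊤ : Submodule R M) := by
    intro r s hrs hx
    rw [Submodule.sup_smul] at hx
    obtain ⟨y, hy, z, hz, rfl⟩ := Submodule.mem_sup.mp hx
    rw [smul_add]
    refine Submodule.add_mem _ (Submodule.smul_mem _ s hy) ?_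
    rw [Submodule.ideal_span_singleton_smul] at hz
    obtain ⟨w, -, rfl⟩ := hz
    change s • r • w ∈ _
    rw [smul_smul]
    exact Submodule.smul_mem_smul hrs Submodule.mem_top
  have h3 := key e (1 - e) (by convert he using 1; ring) h1
  have h4 := key (1 - e) e (by convert he using 1; ring) h2
  have h5 := Submodule.add_mem _ h3 h4
  rwa [← add_smul, sub_add_cancel, one_smul] at h5

end Frobenius

section Idempotent

variable {k R : Type*} [Field k] [CommRing R] [Algebra k R] (𝒜 : ℕ → Submodule k R)

/-- Modulo an ideal of finite colength there is an idempotent `v * u`, with `u` a linear form,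
cutting out the part supported at the primes containing all linear forms. -/
lemma exists_idempotent_linearForm [Infinite k] [IsNoetherianRing R] (I : Ideal R)
    [Module.Finite k (R ⧸ I)] :
    ∃ u ∈ 𝒜 1, ∃ v : R, v * u - (v * u) ^ 2 ∈ I ∧
      ∃ N, Ideal.span (𝒜 1 : Set R) ^ N ≤ I ⊔ Ideal.span {v * u} := by
  have hart : IsArtinianRing (R ⧸ I) := IsArtinianRing.of_finite k _
  obtain ⟨u, hu, hu'⟩ := Submodule.exists_mem_forall_notMem_of_infinite (𝒜 1)
    ((fun P : Ideal R => P.restrictScalars k) '' {P ∈ I.minimalPrimes | ¬ (𝒜 1 : Set R) ⊆ P})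
    ((I.finite_minimalPrimes_of_isNoetherianRing R |>.subset (Set.sep_subset _ _)).image _)
    (by rintro _ ⟨P, ⟨_, hP⟩, rfl⟩ h; exact hP h)
  have hprime : ∀ P : Ideal R, P.IsPrime → I ≤ P → u ∈ P → (𝒜 1 : Set R) ⊆ P := by
    intro P hP hIP huP
    obtain ⟨Q, hQ, hQP⟩ := Ideal.exists_minimalPrimes_le hIP
    have hQp := hQ.1.1
    have hfin : Module.Finite k (R ⧸ Q) := Module.Finite.of_surjective
      (Ideal.Quotient.factorₐ k hQ.1.2).toLinearMap
      (Ideal.Quotient.factor_surjective hQ.1.2)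
    have hart' : IsArtinianRing (R ⧸ Q) := IsArtinianRing.of_finite k _
    have hmax := Ideal.Quotient.maximal_of_isField _ (IsArtinianRing.isField_of_isDomain (R ⧸ Q))
    obtain rfl := hmax.eq_of_le hP.ne_top hQP
    by_contra hcon
    exact hu' _ ⟨Q, ⟨hQ, hcon⟩, rfl⟩ huP
  obtain ⟨n, y, hy⟩ := IsArtinian.exists_pow_succ_smul_dvd (Ideal.Quotient.mk I u) (1 : R ⧸ I)
  obtain ⟨y, rfl⟩ := Ideal.Quotient.mk_surjective y
  set π := Ideal.Quotient.mk I
  have h1 : π u ^ n * (π u * π y) = π u ^ n := by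
    simpa [pow_succ, mul_assoc] using hy
  have h2 : ∀ l, π u ^ n * (π u * π y) ^ l = π u ^ n := by
    intro l
    induction l with
    | zero => simp
    | succ l ih => rw [pow_succ', ← mul_assoc, h1, ih]
  have h3 : π u ^ (n + 1) * (π u * π y) ^ (n + 1) = π u ^ (n + 1) := by
    rw [pow_succ' (π u) n, mul_assoc, h2]
  refine ⟨u, hu, y ^ (n + 1) * u ^ n, ?_, ?_⟩
  · rw [← Ideal.Quotient.eq_zero_iff_mem, map_sub, sub_eq_zero]
    calc π (y ^ (n + 1) * u ^ n * u) = π y ^ (n + 1) * π u ^ (n + 1) := by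
          simp only [map_mul, map_pow]; ring
      _ = π y ^ (n + 1) * (π u ^ (n + 1) * (π u * π y) ^ (n + 1)) := by rw [h3]
      _ = π ((y ^ (n + 1) * u ^ n * u) ^ 2) := by simp only [map_mul, map_pow]; ring
  · refine Ideal.exists_pow_le_of_le_radical_of_fg ?_ (IsNoetherian.noetherian _)
    rw [Ideal.radical_eq_sInf]
    refine le_sInf fun P hP => Ideal.span_le.mpr ?_
    refine hprime P hP.2 (le_sup_left.trans hP.1) ?_
    have he : y ^ (n + 1) * u ^ n * u ∈ P :=
      hP.1 (Submodule.mem_sup_right (Ideal.mem_span_singleton_self _))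
    refine hP.2.mem_of_pow_mem (n + 1) ?_
    have h4 : u ^ (n + 1) - u ^ (n + 1) * (y ^ (n + 1) * u ^ n * u) ∈ I := by
      rw [← Ideal.Quotient.eq_zero_iff_mem, map_sub, sub_eq_zero]
      change π _ = π _
      rw [map_pow, ← h3]
      simp only [map_mul, map_pow]
      ring
    have h5 := P.add_mem (hP.1 (Submodule.mem_sup_left h4)) (P.mul_mem_left (u ^ (n + 1)) he)
    rwa [sub_add_cancel] at h5

end Idempotent

/-- A finite-dimensional subspace contains a subspace with the same image under a linear map,
of dimension at most that of the image. -/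
lemma Submodule.exists_le_finrank_le_map {k V W : Type*} [Field k] [AddCommGroup V]
    [Module k V] [AddCommGroup W] [Module k W] (X : Submodule k V) [FiniteDimensional k X]
    (f : V →ₗ[k] W) : ∃ U ≤ X, Module.finrank k U ≤ Module.finrank k (X.map f) ∧
      ∀ x ∈ X, ∃ z ∈ U, f z = f x := by
  obtain ⟨g, hg⟩ := LinearMap.exists_rightInverse_of_surjective (f.submoduleMap X)
    (LinearMap.range_eq_top.mpr (f.submoduleMap_surjective X))
  refine ⟨LinearMap.range (X.subtype ∘ₗ g), ?_, LinearMap.finrank_range_le _, fun x hx => ?_⟩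
  · rintro _ ⟨y, rfl⟩
    exact (g y).2
  · refine ⟨_, ⟨⟨f x, Submodule.mem_map_of_mem hx⟩, rfl⟩, ?_⟩
    exact congrArg Subtype.val (LinearMap.congr_fun hg ⟨f x, Submodule.mem_map_of_mem hx⟩)

/-- Subspaces killed by a linear map and images under it have complementary dimensions. -/
lemma Submodule.finrank_add_finrank_map_le {k V W : Type*} [Field k] [AddCommGroup V]
    [Module k V] [AddCommGroup W] [Module k W] {X Y : Submodule k V} [FiniteDimensional k Y]
    (hXY : X ≤ Y) (f : V →ₗ[k] W) (hf : ∀ x ∈ X, f x = 0) :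
    Module.finrank k X + Module.finrank k (Y.map f) ≤ Module.finrank k Y := by
  have h1 := (f.domRestrict Y).finrank_range_add_finrank_ker
  rw [LinearMap.range_domRestrict] at h1
  have h2 : Module.finrank k X ≤ Module.finrank k (LinearMap.ker (f.domRestrict Y)) := by
    rw [(Submodule.equivMapOfInjective Y.subtype Y.injective_subtype
      (LinearMap.ker (f.domRestrict Y))).finrank_eq]
    exact Submodule.finrank_mono fun x hx => ⟨⟨x, hXY hx⟩, hf x hx, rfl⟩
  omega

section Comparison

open DirectSum

variable {k R M : Type*} [Field k] [CommRing R] [Algebra k R] [AddCommGroup M] [Module R M]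
  [Module k M] [IsScalarTower k R M] (ℳ : ℕ → Submodule k M) [∀ m, FiniteDimensional k (ℳ m)]

lemma exists_complement_quotientHilbert (N : Submodule R M) (j : ℕ) :
    ∃ U ≤ ℳ j, Module.finrank k U ≤ quotientHilbert ℳ N ⊤ j ∧
      ∀ y ∈ ℳ j, ∃ z ∈ U, y - z ∈ N := by
  obtain ⟨U, hU, hr, hy⟩ := (ℳ j).exists_le_finrank_le_map (N.mkQ.restrictScalars k)
  refine ⟨U, hU, ?_, fun y hyj => ?_⟩
  · rwa [quotientHilbert, Submodule.restrictScalars_top, top_inf_eq]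
  · obtain ⟨z, hz, hzy⟩ := hy y hyj
    exact ⟨z, hz, (Submodule.Quotient.eq N).mp hzy.symm⟩

omit [∀ m, FiniteDimensional k (ℳ m)] in
lemma finrank_inf_le_quotientHilbert_bot (L : Submodule R M) (j : ℕ)
    [FiniteDimensional k (ℳ j)] :
    Module.finrank k ↥(L.restrictScalars k ⊓ ℳ j) ≤ quotientHilbert ℳ ⊥ L j := by
  have : FiniteDimensional k ↥(L.restrictScalars k ⊓ ℳ j) :=
    Submodule.finiteDimensional_of_le inf_le_right
  have h := Submodule.finrank_le_finrank_map_add (L.restrictScalars k ⊓ ℳ j) ⊥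
    ((⊥ : Submodule R M).mkQ.restrictScalars k) fun x _ hx =>
      (Submodule.mem_bot k).mpr ((Submodule.mem_bot R).mp
        ((Submodule.Quotient.mk_eq_zero _).mp hx))
  rwa [finrank_bot, add_zero] at h

variable {M' : Type*} [AddCommGroup M'] [Module R M'] [Module k M'] [IsScalarTower k R M']
  (ℳ' : ℕ → Submodule k M') [∀ m, FiniteDimensional k (ℳ' m)]

variable [Decomposition ℳ] [Decomposition ℳ'] {ψ : M' →ₗ[R] M}

omit [IsScalarTower k R M'] [∀ m, FiniteDimensional k (ℳ' m)] in
lemma exists_complement_range (hψ : ∀ m : ℕ, ∀ x ∈ ℳ' m, ψ x ∈ ℳ m) (j : ℕ) :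
    ∃ U ≤ ℳ j, Module.finrank k U ≤ quotientHilbert ℳ (LinearMap.range ψ) ⊤ j ∧
      ∀ y ∈ ℳ j, ∃ z ∈ U, ∃ w ∈ ℳ' j, y = z + ψ w := by
  obtain ⟨U, hU, hr, hy⟩ := exists_complement_quotientHilbert ℳ (LinearMap.range ψ) j
  refine ⟨U, hU, hr, fun y hyj => ?_⟩
  obtain ⟨z, hz, w, hw⟩ := hy y hyj
  refine ⟨z, hz, gradedProj ℳ' j w, gradedProj_mem ℳ' j w, ?_⟩
  rw [← gradedProj_map ℳ' ℳ hψ, hw, gradedProj_of_mem ℳ ((ℳ j).sub_mem hyj (hU hz)),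
    add_sub_cancel]

/-- The degree `m` component of `M/JM` is bounded in terms of that of `M'/JM'` and the
cokernel of `M' → M`. -/
lemma finrank_map_mkQ_le_add_range (hψ : ∀ m : ℕ, ∀ x ∈ ℳ' m, ψ x ∈ ℳ m) (J : Ideal R) (m : ℕ) :
    Module.finrank k ((ℳ m).map ((J • (⊤ : Submodule R M)).mkQ.restrictScalars k)) ≤
      Module.finrank k ((ℳ' m).map ((J • (⊤ : Submodule R M')).mkQ.restrictScalars k)) +
        quotientHilbert ℳ (LinearMap.range ψ) ⊤ m := by
  set π := (J • (⊤ : Submodule R M)).mkQ.restrictScalars k with hπ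
  set π' := (J • (⊤ : Submodule R M')).mkQ.restrictScalars k with hπ'
  obtain ⟨U, hU, hr, hy⟩ := exists_complement_range ℳ ℳ' hψ m
  have hle : J • (⊤ : Submodule R M') ≤ (J • (⊤ : Submodule R M)).comap ψ := by
    rw [← Submodule.map_le_iff_le_comap, Submodule.map_smul'']
    exact Submodule.smul_mono le_rfl le_top
  let f := (Submodule.mapQ _ _ ψ hle).restrictScalars k
  have : FiniteDimensional k U := Submodule.finiteDimensional_of_le hU
  have h1 : (ℳ m).map π ≤ ((ℳ' m).map π').map f ⊔ U.map π := by
    rintro _ ⟨y, hyj, rfl⟩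
    obtain ⟨z, hz, w, hw, rfl⟩ := hy y hyj
    rw [map_add, add_comm]
    exact Submodule.add_mem_sup ⟨π' w, ⟨w, hw, rfl⟩, rfl⟩ ⟨z, hz, rfl⟩
  calc _ ≤ _ := Submodule.finrank_mono h1
    _ ≤ _ := Submodule.finrank_add_le_finrank_add_finrank _ _
    _ ≤ _ := add_le_add (Submodule.finrank_map_le _ _) ((Submodule.finrank_map_le _ _).trans hr)

variable (𝒜 : ℕ → Submodule k R) [GradedAlgebra 𝒜] [SetLike.GradedSMul 𝒜 ℳ']

omit [Module k M] [IsScalarTower k R M] in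
/-- If a linear form is a unit modulo `J`, then the dimension of the part of the degree `m`
component of `M'/JM'` dying in `M/JM` is controlled by an element of `R` annihilating kernel
and cokernel of `M' → M`. -/
lemma finrank_map_mkQ_le_of_unit (J : Ideal R) {u v : R} (hu : u ∈ 𝒜 1) (huv : 1 - v * u ∈ J)
    {e : ℕ} {a : R} (ha : a ∈ 𝒜 e) (hker : ∀ x, ψ x = 0 → a • x = 0)
    (hcoker : ∀ y, a • y ∈ LinearMap.range ψ) (m : ℕ) :
    Module.finrank k ((ℳ' m ⊓ ((J • (⊤ : Submodule R M)).comap ψ).restrictScalars k).map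
      ((J • (⊤ : Submodule R M')).mkQ.restrictScalars k)) ≤
        quotientHilbert ℳ' ((⊤ : Submodule R M').map (LinearMap.lsmul R M' (a ^ 2))) ⊤
          (e * 2 + m) := by
  set π := (J • (⊤ : Submodule R M')).mkQ.restrictScalars k with hπ
  set Y := (ℳ' m).map π with hY
  set Y' := (ℳ' (e * 2 + m)).map π with hY'
  set X := (ℳ' m ⊓ ((J • (⊤ : Submodule R M)).comap ψ).restrictScalars k).map π with hX
  let α : (M' ⧸ J • (⊤ : Submodule R M')) →ₗ[k] (M' ⧸ J • (⊤ : Submodule R M')) :=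
    (LinearMap.lsmul R _ (a ^ 2)).restrictScalars k
  let β : (M' ⧸ J • (⊤ : Submodule R M')) →ₗ[k] (M' ⧸ J • (⊤ : Submodule R M')) :=
    (LinearMap.lsmul R _ (u ^ (e * 2))).restrictScalars k
  have hα : ∀ x ∈ X, α x = 0 := by
    rintro _ ⟨x, ⟨-, hx⟩, rfl⟩
    have h1 : a • ψ x ∈ (J • (⊤ : Submodule R M')).map ψ := by
      rw [Submodule.map_smul'', Submodule.map_top]
      have h2 : J • (⊤ : Submodule R M) ≤
          (J • LinearMap.range ψ).comap (LinearMap.lsmul R M a) := by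
        refine Submodule.smul_le.mpr fun r hr y _ => ?_
        change a • r • y ∈ (J • LinearMap.range ψ : Submodule R M)
        rw [smul_comm]
        exact Submodule.smul_mem_smul hr (hcoker y)
      exact h2 hx
    obtain ⟨w, hw, hwx⟩ := h1
    have h3 : a • (a • x - w) = 0 := hker _ (by rw [map_sub, map_smul, hwx, sub_self])
    rw [smul_sub, smul_smul, ← pow_two, sub_eq_zero] at h3
    change Submodule.Quotient.mk (a ^ 2 • x) = 0
    rw [h3]
    exact (Submodule.Quotient.mk_eq_zero _).mpr (Submodule.smul_mem _ a hw)
  have hβ : Function.Injective β := by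
    have hvu : ∀ y : M' ⧸ J • (⊤ : Submodule R M'), (v * u) • y = y := by
      intro y
      obtain ⟨x, rfl⟩ := Submodule.mkQ_surjective _ y
      have h1 := (Submodule.Quotient.mk_eq_zero (J • (⊤ : Submodule R M'))).mpr
        (Submodule.smul_mem_smul huv (Submodule.mem_top (x := x)))
      rw [sub_smul, one_smul, Submodule.Quotient.mk_sub, sub_eq_zero] at h1
      exact h1.symm
    have hvu' : ∀ (n : ℕ) (y : M' ⧸ J • (⊤ : Submodule R M')), (v * u) ^ n • y = y := by
      intro n y
      induction n with
      | zero => rw [pow_zero, one_smul]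
      | succ n ih => rw [pow_succ, mul_smul, hvu, ih]
    intro y z hyz
    have h1 : u ^ (e * 2) • y = u ^ (e * 2) • z := hyz
    rw [← hvu' (e * 2) y, ← hvu' (e * 2) z, mul_pow, mul_smul, mul_smul, h1]
  have hYY' : Y.map β ≤ Y' := by
    rintro _ ⟨_, ⟨x, hx, rfl⟩, rfl⟩
    refine ⟨u ^ (e * 2) • x, ?_, rfl⟩
    have h1 := smul_mem_graded ℳ' 𝒜 (SetLike.pow_mem_graded (e * 2) hu) hx
    rwa [smul_eq_mul, mul_one] at h1
  obtain ⟨U, hU, hr, hUy⟩ := exists_complement_quotientHilbert ℳ'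
    ((⊤ : Submodule R M').map (LinearMap.lsmul R M' (a ^ 2))) (e * 2 + m)
  have : FiniteDimensional k U := Submodule.finiteDimensional_of_le hU
  have hY'α : Y' ≤ Y.map α ⊔ U.map π := by
    rintro _ ⟨y, hy, rfl⟩
    obtain ⟨z, hz, w, -, hw⟩ := hUy y hy
    have ha2 : a ^ 2 ∈ 𝒜 (e * 2) := by
      simpa [mul_comm] using SetLike.pow_mem_graded 2 ha
    have h1 : y = a ^ 2 • gradedProj ℳ' m w + z := by
      rw [← gradedProj_smul ℳ' 𝒜 ha2]
      change a ^ 2 • w = y - z at hw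
      rw [hw, gradedProj_of_mem ℳ' (Submodule.sub_mem _ hy (hU hz)), sub_add_cancel]
    rw [h1, map_add]
    exact Submodule.add_mem_sup ⟨π (gradedProj ℳ' m w), ⟨_, gradedProj_mem ℳ' m w, rfl⟩, rfl⟩
      ⟨z, hz, rfl⟩
  have hXY : X ≤ Y := Submodule.map_mono inf_le_left
  have e1 := Submodule.finrank_add_finrank_map_le hXY α hα
  have e2 : Module.finrank k Y ≤ Module.finrank k Y' := by
    rw [(Submodule.equivMapOfInjective β hβ Y).finrank_eq]
    exact Submodule.finrank_mono hYY'
  have e3 : Module.finrank k Y' ≤ Module.finrank k (Y.map α) + Module.finrank k U :=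
    (Submodule.finrank_mono hY'α).trans ((Submodule.finrank_add_le_finrank_add_finrank _ _).trans
      (Nat.add_le_add_left (Submodule.finrank_map_le _ _) _))
  omega

end Comparison

section FrobeniusDegrees

open DirectSum

lemma Ideal.span_pow_le_span_image_pow {R : Type*} [CommRing R] (X : Finset R) (t : ℕ) :
    Ideal.span (X : Set R) ^ (X.card * t + 1) ≤ Ideal.span ((fun x => x ^ t) '' (X : Set R)) := by
  classical
  induction X using Finset.induction_on with
  | empty => simp
  | insert x X hx ih =>
    rw [Finset.card_insert_of_notMem hx, Finset.coe_insert, Set.image_insert_eq,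
      Ideal.span_insert, Ideal.span_insert,
      show (X.card + 1) * t + 1 = t + (X.card * t + 1) by ring]
    refine Ideal.sup_pow_add_le_pow_sup_pow.trans (sup_le_sup ?_ ih)
    rw [Ideal.span_singleton_pow]

/-- Multiplication by a `q`-th power shifts degrees by multiples of `q`. -/
lemma exists_pow_smul_mem_iSup {k R M : Type*} [Field k] [CommRing R] [Algebra k R]
    (𝒜 : ℕ → Submodule k R) [GradedAlgebra 𝒜] [AddCommGroup M] [Module R M] [Module k M]
    (ℳ : ℕ → Submodule k M) [SetLike.GradedSMul 𝒜 ℳ] (p : ℕ) [ExpChar R p] (F : Finset R) :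
    ∃ Δ, ∀ f ∈ F, ∀ n j, ∀ y ∈ ℳ j,
      f ^ p ^ n • y ∈ ⨆ i ∈ {i | ∃ l ≤ Δ, i = p ^ n * l + j}, ℳ i := by
  choose s hs using exists_sum_gradedProj 𝒜
  refine ⟨F.sup fun f => (s f).sup id, fun f hf n j y hy => ?_⟩
  have h1 : f ^ p ^ n = ∑ l ∈ s f, gradedProj 𝒜 l f ^ p ^ n := by
    conv_lhs => rw [hs f]
    simp only [← iterateFrobenius_def, map_sum]
  rw [h1, Finset.sum_smul]
  refine Submodule.sum_mem _ fun l hl => ?_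
  refine Submodule.mem_iSup_of_mem (p ^ n * l + j) (Submodule.mem_iSup_of_mem ⟨l, ?_, rfl⟩ ?_)
  · exact (Finset.le_sup (f := id) hl).trans (Finset.le_sup (f := fun f => (s f).sup id) hf)
  · exact smul_mem_graded ℳ 𝒜 (SetLike.pow_mem_graded (p ^ n) (gradedProj_mem 𝒜 l f)) hy

variable {k R M : Type*} [Field k] [CommRing R] [Algebra k R] (𝒜 : ℕ → Submodule k R)
  [GradedAlgebra 𝒜] [AddCommGroup M] [Module R M] [Module k M] [IsScalarTower k R M]
  (ℳ : ℕ → Submodule k M) [SetLike.GradedSMul 𝒜 ℳ] [Decomposition ℳ]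

/-- Elements of large degree are combinations of elements `x ^ t • w` with `x` running through
a finite set of linear forms. -/
lemma exists_mem_span_pow_smul_of_degree_ge [IsNoetherian R M]
    (hstd : ∀ m : ℕ, (𝒜 (m + 1) : Set R) ⊆
      Submodule.span k (Set.image2 (· * ·) (𝒜 1 : Set R) (𝒜 m : Set R)))
    {X : Finset R} (hX : (X : Set R) ⊆ 𝒜 1)
    (hspan : Ideal.span (𝒜 1 : Set R) = Ideal.span (X : Set R)) :
    ∃ δ, ∀ t j, δ + (X.card * t + 1) ≤ j → ∀ y ∈ ℳ j,
      y ∈ Submodule.span k {z | ∃ x ∈ X, ∃ i, i + t = j ∧ ∃ w ∈ ℳ i, z = x ^ t • w} := by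
  have htop : (⊤ : Submodule R M).IsHomogeneous ℳ := fun _ _ _ => Submodule.mem_top
  obtain ⟨δ, hδ⟩ := exists_mem_pow_smul_of_degree_ge 𝒜 ℳ hstd htop
  refine ⟨δ, fun t j hj y hy => ?_⟩
  set G := {g : M | ∃ x ∈ X, ∃ i, ∃ w ∈ ℳ i, g = x ^ t • w}
  have h1 : y ∈ Submodule.span R G := by
    have h2 := Submodule.smul_mono_left (N := (⊤ : Submodule R M))
      (hspan ▸ Ideal.span_pow_le_span_image_pow X t) (hδ (X.card * t + 1) j hj y trivial hy)
    refine (Submodule.smul_le.mpr fun r hr w _ => ?_ :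
      Ideal.span ((fun x => x ^ t) '' (X : Set R)) • (⊤ : Submodule R M) ≤ _) h2
    refine Submodule.span_induction (p := fun r _ => ∀ w : M, r • w ∈ Submodule.span R G)
      ?_ (fun w => by simp) (fun a b _ _ ha hb w => ?_) (fun a b _ hb w => ?_) hr w
    · rintro _ ⟨x, hx, rfl⟩ w
      obtain ⟨s, hs⟩ := exists_sum_gradedProj ℳ w
      rw [hs, Finset.smul_sum]
      exact Submodule.sum_mem _ fun i _ =>
        Submodule.subset_span ⟨x, hx, i, _, gradedProj_mem ℳ i w, rfl⟩
    · rw [add_smul]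
      exact Submodule.add_mem _ (ha w) (hb w)
    · rw [smul_eq_mul, mul_smul]
      exact Submodule.smul_mem _ a (hb w)
  have hdeg : ∀ x ∈ X, x ^ t ∈ 𝒜 t := fun x hx => by
    have h2 := SetLike.pow_mem_graded t (hX hx)
    rwa [smul_eq_mul, mul_one] at h2
  have h2 := mem_span_homogeneous_smul_of_mem 𝒜 ℳ (G := G) ?_ h1 hy
  · refine Submodule.span_le.mpr ?_ h2
    rintro _ ⟨i, l, rfl, a, ha, _, ⟨x, hx, i', w, hw, rfl⟩, hl, rfl⟩
    by_cases h0 : x ^ t • w = 0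
    · rw [h0, smul_zero]
      exact Submodule.zero_mem _
    have hil : t + i' = l := by
      by_contra hne
      have h3 := gradedProj_of_mem_ne ℳ (smul_mem_graded ℳ 𝒜 (hdeg x hx) hw) hne
      rw [gradedProj_of_mem ℳ hl] at h3
      exact h0 h3
    subst hil
    refine Submodule.subset_span ⟨x, hx, i + i', by omega, a • w,
      smul_mem_graded ℳ 𝒜 ha hw, smul_comm _ _ _⟩
  · rintro _ ⟨x, hx, i, w, hw, rfl⟩
    exact ⟨_, smul_mem_graded ℳ 𝒜 (hdeg x hx) hw⟩

/-- Homogeneous elements of `(f ^ q : f ∈ F) • M` only need coefficients of bounded degree,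
congruent modulo `q` to the given degree. -/
lemma exists_mem_span_pow_smul [IsNoetherian R M]
    (hstd : ∀ m : ℕ, (𝒜 (m + 1) : Set R) ⊆
      Submodule.span k (Set.image2 (· * ·) (𝒜 1 : Set R) (𝒜 m : Set R)))
    (p : ℕ) [ExpChar R p] {X F : Finset R} (hX : (X : Set R) ⊆ 𝒜 1)
    (hspan : Ideal.span (𝒜 1 : Set R) = Ideal.span (X : Set R))
    {N : ℕ} (hXF : ∀ x ∈ X, x ^ N ∈ F) (c : ℕ) :
    ∃ B, ∀ n m, m ≤ c * p ^ n → ∀ y ∈ ℳ m,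
      y ∈ Ideal.span ((fun f => f ^ p ^ n) '' (F : Set R)) • (⊤ : Submodule R M) →
      y ∈ Submodule.span k {z | ∃ f ∈ F, ∃ j ≤ B * p ^ n, j ≡ m [MOD p ^ n] ∧
        ∃ w ∈ ℳ j, z = f ^ p ^ n • w} := by
  obtain ⟨δ, hδ⟩ := exists_mem_span_pow_smul_of_degree_ge 𝒜 ℳ hstd hX hspan
  obtain ⟨Δ, hΔ⟩ := exists_pow_smul_mem_iSup 𝒜 ℳ p F
  set B₀ := δ + X.card * N + 1
  refine ⟨B₀ + c + Δ, fun n m hm y hy hyJ => ?_⟩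
  set B := B₀ + c + Δ with hB
  have hq : 0 < p ^ n := pow_pos (expChar_pos R p) n
  set q := p ^ n
  set T := Submodule.span k {z | ∃ f ∈ F, ∃ j ≤ B * q, j ≡ m [MOD q] ∧
        ∃ w ∈ ℳ j, z = f ^ q • w}
  set S : Set ℕ := {j | j ≡ m [MOD q] ∧ j ≤ B * q}
  set T' := T ⊓ ⨆ j ∈ S, ℳ j
  set Z := ⨆ j ∈ Sᶜ, ℳ j
  have hmodq : ∀ l j : ℕ, q * l + j ≡ j [MOD q] := fun l j => by simp [Nat.ModEq]
  have hlin : ∀ x ∈ X, ∀ i, i ≡ m [MOD q] → ∀ w ∈ ℳ i, x ^ (N * q) • w ∈ T' ⊔ Z := by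
    intro x hx i hi w hw
    have hdeg : x ^ (N * q) • w ∈ ℳ (N * q + i) := by
      have h1 := SetLike.pow_mem_graded (N * q) (hX hx)
      rw [smul_eq_mul, mul_one] at h1
      exact smul_mem_graded ℳ 𝒜 h1 hw
    have hmod : N * q + i ≡ m [MOD q] := by
      rw [mul_comm]
      exact (hmodq N i).trans hi
    by_cases hle : N * q + i ≤ B * q
    · refine Submodule.mem_sup_left ⟨Submodule.subset_span ⟨x ^ N, hXF x hx, i, by omega, hi, w,
        hw, by rw [pow_mul]⟩, ?_⟩
      exact Submodule.mem_iSup_of_mem _ (Submodule.mem_iSup_of_mem ⟨hmod, hle⟩ hdeg)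
    · exact Submodule.mem_sup_right (Submodule.mem_iSup_of_mem _ (Submodule.mem_iSup_of_mem
        (fun h => hle h.2) hdeg))
  have hgen : ∀ f ∈ F, ∀ j, ∀ w ∈ ℳ j, f ^ q • w ∈ T' ⊔ Z := by
    intro f hf j w hw
    by_cases hj : j ≡ m [MOD q]
    · rcases lt_or_ge j (B₀ * q) with hlt | hge
      · have h2 : B₀ * q + (c + Δ) * q = B * q := by rw [hB]; ring
        refine Submodule.mem_sup_left ⟨Submodule.subset_span ⟨f, hf, j, by omega, hj, w, hw, rfl⟩,
          ?_⟩
        refine (biSup_mono ?_ : _ ≤ ⨆ i ∈ S, ℳ i) (hΔ f hf n j w hw)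
        rintro _ ⟨l, hl, rfl⟩
        refine ⟨(hmodq l j).trans hj, ?_⟩
        change q * l + j ≤ B * q
        have h3 : q * l ≤ q * Δ := Nat.mul_le_mul_left q hl
        have h4 : B * q = B₀ * q + c * q + q * Δ := by rw [hB]; ring
        omega
      · have h1 : δ + (X.card * (N * q) + 1) ≤ j := by
          have h2 : B₀ * q = δ * q + X.card * (N * q) + q := by simp only [B₀]; ring
          have h3 : δ ≤ δ * q := Nat.le_mul_of_pos_right δ hq
          omega
        have h2 : ∀ v ∈ Submodule.span k {z | ∃ x ∈ X, ∃ i, i + N * q = j ∧ ∃ w ∈ ℳ i,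
            z = x ^ (N * q) • w}, f ^ q • v ∈ T' ⊔ Z := by
          intro v hv
          induction hv using Submodule.span_induction with
          | mem v hv =>
            obtain ⟨x, hx, i, rfl, w, hw, rfl⟩ := hv
            rw [smul_comm]
            have hi : i ≡ m [MOD q] := by
              refine ((hmodq N i).symm.trans ?_)
              rwa [add_comm, mul_comm]
            have hmem := hΔ f hf n i w hw
            refine (?_ : (⨆ i' ∈ {i' | ∃ l ≤ Δ, i' = p ^ n * l + i}, ℳ i') ≤
              (T' ⊔ Z).comap ((LinearMap.lsmul R M (x ^ (N * q))).restrictScalars k)) hmem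
            refine iSup₂_le fun i' hi' z hz => ?_
            obtain ⟨l, -, rfl⟩ := hi'
            exact hlin x hx _ ((hmodq l i).trans hi) z hz
          | zero => rw [smul_zero]; exact Submodule.zero_mem _
          | add a b _ _ ha hb => rw [smul_add]; exact Submodule.add_mem _ ha hb
          | smul r v _ hv => rw [smul_comm]; exact Submodule.smul_mem _ r hv
        exact h2 w (hδ _ j h1 w hw)
    · refine Submodule.mem_sup_right ?_
      refine (biSup_mono ?_ : _ ≤ Z) (hΔ f hf n j w hw)
      rintro _ ⟨l, -, rfl⟩ hcon
      exact hj ((hmodq l j).symm.trans hcon.1)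
  have hJ : y ∈ T' ⊔ Z := by
    refine Submodule.smul_induction_on hyJ (fun r hr w _ => ?_) fun a b ha hb =>
      Submodule.add_mem _ ha hb
    refine Submodule.span_induction (p := fun r _ => ∀ w : M, r • w ∈ T' ⊔ Z)
      ?_ (fun w => by simp) (fun a b _ _ ha hb w => ?_) (fun a b _ hb w => ?_) hr w
    · rintro _ ⟨f, hf, rfl⟩ w
      obtain ⟨s, hs⟩ := exists_sum_gradedProj ℳ w
      rw [hs, Finset.smul_sum]
      exact Submodule.sum_mem _ fun j _ => hgen f hf j _ (gradedProj_mem ℳ j w)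
    · rw [add_smul]
      exact Submodule.add_mem _ (ha w) (hb w)
    · rw [smul_eq_mul, mul_comm, mul_smul]
      exact hb (a • w)
  obtain ⟨w, hw, z, hz, hwz⟩ := Submodule.mem_sup.mp hJ
  have hyS : y ∈ ⨆ j ∈ S, ℳ j := by
    refine Submodule.mem_iSup_of_mem m (Submodule.mem_iSup_of_mem ⟨rfl, ?_⟩ hy)
    exact hm.trans (Nat.mul_le_mul_right q (by omega))
  have hz0 : z = 0 := by
    refine Submodule.disjoint_def.mp (disjoint_iSup_graded ℳ (disjoint_compl_right (a := S))) z
      ?_ hz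
    rw [← add_sub_cancel_left w z, hwz]
    exact Submodule.sub_mem _ hyS hw.2
  rw [← hwz, hz0, add_zero]
  exact hw.1

end FrobeniusDegrees

lemma Submodule.finrank_finset_sup_le {k V ι : Type*} [Field k] [AddCommGroup V] [Module k V]
    (s : Finset ι) (W : ι → Submodule k V) [∀ i, FiniteDimensional k (W i)] :
    Module.finrank k ↥(s.sup W) ≤ ∑ i ∈ s, Module.finrank k (W i) := by
  classical
  induction s using Finset.induction_on with
  | empty => simp
  | insert i s hi ih =>
    rw [Finset.sup_insert, Finset.sum_insert hi]
    exact (Submodule.finrank_add_le_finrank_add_finrank _ _).trans (Nat.add_le_add_left ih _)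

lemma card_filter_modEq_le (B m q : ℕ) :
    {j ∈ Finset.range (B * q + 1) | j ≡ m [MOD q]}.card ≤ B + 1 := by
  rw [← Finset.card_range (B + 1)]
  refine Finset.card_le_card_of_injOn (fun j => j / q) (fun j hj => ?_) fun i hi j hj hij => ?_
  · simp only [Finset.coe_filter, Set.mem_ofPred_eq, Finset.mem_range] at hj
    simp only [Finset.coe_range, Set.mem_Iio]
    exact Nat.lt_succ_of_le (Nat.div_le_of_le_mul (by rw [mul_comm]; omega))
  · simp only [Finset.coe_filter, Set.mem_ofPred_eq] at hi hj
    have h1 : i % q = j % q := hi.2.trans hj.2.symm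
    have h2 : i / q = j / q := hij
    rw [← Nat.div_add_mod i q, ← Nat.div_add_mod j q, h1, h2]

/-- A function of growth `j ^ D`, summed over a residue class modulo `q` up to a multiple of `q`. -/
lemma sum_filter_modEq_le {h : ℕ → ℕ} {C D : ℕ} (hh : ∀ j, h j ≤ C * (j + 1) ^ D) (B m : ℕ)
    {q : ℕ} (hq : 0 < q) :
    ∑ j ∈ Finset.range (B * q + 1) with j ≡ m [MOD q], h j ≤
      (B + 1) * (C * (B + 1) ^ D) * q ^ D := by
  calc _ ≤ ∑ j ∈ Finset.range (B * q + 1) with j ≡ m [MOD q], C * ((B + 1) * q) ^ D := by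
        refine Finset.sum_le_sum fun j hj => (hh j).trans ?_
        have := Finset.mem_range.mp (Finset.mem_filter.mp hj).1
        have : (B + 1) * q = B * q + q := by ring
        gcongr
        omega
    _ ≤ _ := by
        rw [Finset.sum_const, smul_eq_mul]
        refine (Nat.mul_le_mul_right _ (card_filter_modEq_le B m q)).trans (le_of_eq ?_)
        rw [mul_pow]
        ring

section Comparison

open DirectSum

variable {k R M M' : Type*} [Field k] [CommRing R] [Algebra k R] [AddCommGroup M] [Module R M]
  [Module k M] [IsScalarTower k R M] (ℳ : ℕ → Submodule k M) [∀ m, FiniteDimensional k (ℳ m)]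
  [Decomposition ℳ] [AddCommGroup M'] [Module R M'] [Module k M'] [IsScalarTower k R M']
  (ℳ' : ℕ → Submodule k M') [∀ m, FiniteDimensional k (ℳ' m)] [Decomposition ℳ']
  {ψ : M' →ₗ[R] M}

/-- If the degree `m` component of `JM` is generated by finitely many elements of `J` with
coefficients of degrees in `S`, then the part of the degree `m` component of `M'/JM'` dying in
`M/JM` is bounded by Hilbert functions of the cokernel and the kernel of `M' → M`. -/
lemma finrank_map_mkQ_le_sum (hψ : ∀ m : ℕ, ∀ x ∈ ℳ' m, ψ x ∈ ℳ m) (J : Ideal R)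
    {F : Finset R} (hFJ : ∀ f ∈ F, f ∈ J) {S S' : Finset ℕ} {m : ℕ} (hm : m ∈ S')
    (hF : ∀ y ∈ ℳ m, y ∈ J • (⊤ : Submodule R M) →
      y ∈ Submodule.span k {z | ∃ f ∈ F, ∃ j ∈ S, ∃ w ∈ ℳ j, z = f • w})
    (hS' : ∀ f ∈ F, ∀ j ∈ S, ∀ w ∈ ℳ' j, f • w ∈ S'.sup ℳ') :
    Module.finrank k ((ℳ' m ⊓ ((J • (⊤ : Submodule R M)).comap ψ).restrictScalars k).map
      ((J • (⊤ : Submodule R M')).mkQ.restrictScalars k)) ≤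
        F.card * (∑ j ∈ S, quotientHilbert ℳ (LinearMap.range ψ) ⊤ j) +
          ∑ j ∈ S', quotientHilbert ℳ' ⊥ (LinearMap.ker ψ) j := by
  choose U hU hUr hUy using exists_complement_range ℳ ℳ' hψ
  have hUfin : ∀ j, FiniteDimensional k (U j) := fun j => Submodule.finiteDimensional_of_le (hU j)
  let W : R → ℕ → Submodule k M := fun f j => (U j).map ((LinearMap.lsmul R M f).restrictScalars k)
  set V := F.sup fun f => S.sup (W f)
  have hVmem : ∀ f ∈ F, ∀ j ∈ S, ∀ z ∈ U j, f • z ∈ V := fun f hf j hj z hz =>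
    Finset.le_sup (f := fun f => S.sup (W f)) hf (Finset.le_sup (f := W f) hj ⟨z, hz, rfl⟩)
  have hV : Module.finrank k V ≤
      F.card * ∑ j ∈ S, quotientHilbert ℳ (LinearMap.range ψ) ⊤ j := by
    refine (Submodule.finrank_finset_sup_le _ _).trans ?_
    rw [← smul_eq_mul, ← Finset.sum_const]
    exact Finset.sum_le_sum fun f _ => (Submodule.finrank_finset_sup_le _ _).trans
      (Finset.sum_le_sum fun j _ => (Submodule.finrank_map_le _ _).trans (hUr j))
  set L := S'.sup ℳ'
  have hL : ∀ j ∈ S', ℳ' j ≤ L := fun j hj => Finset.le_sup hj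
  set E := L ⊓ V.comap (ψ.restrictScalars k)
  have hEfin : FiniteDimensional k E := Submodule.finiteDimensional_of_le inf_le_left
  let T : ℕ → Submodule k M' := fun j => (LinearMap.ker ψ).restrictScalars k ⊓ ℳ' j
  have hTfin : ∀ j, FiniteDimensional k (T j) := fun j =>
    Submodule.finiteDimensional_of_le inf_le_right
  have hT : Module.finrank k ↥(S'.sup T) ≤ ∑ j ∈ S', quotientHilbert ℳ' ⊥ (LinearMap.ker ψ) j :=
    (Submodule.finrank_finset_sup_le _ _).trans (Finset.sum_le_sum fun j _ =>
      finrank_inf_le_quotientHilbert_bot ℳ' _ j)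
  have hE : Module.finrank k E ≤ Module.finrank k V + Module.finrank k ↥(S'.sup T) := by
    refine (Submodule.finrank_le_finrank_map_add E (S'.sup T) (ψ.restrictScalars k) ?_).trans
      (Nat.add_le_add_right (Submodule.finrank_mono (Submodule.map_le_iff_le_comap.mpr
        inf_le_right)) _)
    rintro x ⟨hxL, -⟩ hx
    have hproj : ∀ j, j ∉ S' → gradedProj ℳ' j x = 0 := by
      intro j hj
      refine (Finset.sup_le fun i hi z hz => ?_ : L ≤ LinearMap.ker (gradedProj ℳ' j)) hxL
      exact gradedProj_of_mem_ne ℳ' hz (by rintro rfl; exact hj hi)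
    obtain ⟨s, hs⟩ := exists_sum_gradedProj ℳ' x
    rw [hs]
    refine Submodule.sum_mem _ fun j _ => ?_
    by_cases hj : j ∈ S'
    · exact Finset.le_sup (f := T) hj
        ⟨isHomogeneous_ker ℳ' ℳ hψ j hx, gradedProj_mem ℳ' j x⟩
    · rw [hproj j hj]
      exact Submodule.zero_mem _
  set π := (J • (⊤ : Submodule R M')).mkQ.restrictScalars k
  have hXE : (ℳ' m ⊓ ((J • (⊤ : Submodule R M)).comap ψ).restrictScalars k).map π ≤ E.map π := by
    rintro _ ⟨x, ⟨hxm, hxJ⟩, rfl⟩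
    have hP : ψ x ∈ V ⊔ ((J • (⊤ : Submodule R M')).restrictScalars k ⊓ L).map
        (ψ.restrictScalars k) := by
      refine Submodule.span_le.mpr ?_ (hF (ψ x) (hψ m x hxm) hxJ)
      rintro _ ⟨f, hf, j, hj, w, hw, rfl⟩
      obtain ⟨z, hz, w', hw', rfl⟩ := hUy j w hw
      have hJ : f • w' ∈ (J • (⊤ : Submodule R M')).restrictScalars k :=
        (Submodule.smul_mem_smul (hFJ f hf) Submodule.mem_top : f • w' ∈ J • (⊤ : Submodule R M'))
      have hmap : ψ (f • w') ∈ ((J • (⊤ : Submodule R M')).restrictScalars k ⊓ L).map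
          (ψ.restrictScalars k) :=
        Submodule.mem_map_of_mem (f := ψ.restrictScalars k)
          (Submodule.mem_inf.mpr ⟨hJ, hS' f hf j hj w' hw'⟩)
      rw [smul_add]
      rw [map_smul] at hmap
      exact Submodule.add_mem_sup (hVmem f hf j hj z hz) hmap
    obtain ⟨v, hv, _, ⟨g, ⟨hgJ, hgL⟩, rfl⟩, hvg⟩ := Submodule.mem_sup.mp hP
    have hxg : ψ (x - g) ∈ V := by
      rw [map_sub, ← hvg, LinearMap.restrictScalars_apply, add_sub_cancel_right]
      exact hv
    have hπg : π g = 0 := (Submodule.Quotient.mk_eq_zero _).mpr hgJ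
    refine Submodule.mem_map.mpr ⟨x - g,
      Submodule.mem_inf.mpr ⟨Submodule.sub_mem _ (hL m hm hxm) hgL, hxg⟩, ?_⟩
    rw [map_sub, hπg, sub_zero]
  calc _ ≤ Module.finrank k (E.map π) := Submodule.finrank_mono hXE
    _ ≤ Module.finrank k E := Submodule.finrank_map_le _ _
    _ ≤ _ := by omega

/-- If some power of the ideal of linear forms lies in `I`, then the dimension of the part of the
degree `m` component of `M'/I^{[q]}M'` dying in `M/I^{[q]}M` is `O(q ^ D)` for `m = O(q)`,
as soon as the kernel and the cokernel of `M' → M` have Hilbert functions of growth `j ^ D`. -/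
lemma exists_finrank_map_mkQ_le_of_pow_le (𝒜 : ℕ → Submodule k R) [GradedAlgebra 𝒜]
    [SetLike.GradedSMul 𝒜 ℳ'] [SetLike.GradedSMul 𝒜 ℳ] [IsNoetherianRing R] [IsNoetherian R M]
    (hstd : ∀ m : ℕ, (𝒜 (m + 1) : Set R) ⊆
      Submodule.span k (Set.image2 (· * ·) (𝒜 1 : Set R) (𝒜 m : Set R)))
    (p : ℕ) [ExpChar R p] (hψ : ∀ m : ℕ, ∀ x ∈ ℳ' m, ψ x ∈ ℳ m) (I : Ideal R) {N : ℕ}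
    (hI : Ideal.span (𝒜 1 : Set R) ^ N ≤ I) {C D : ℕ}
    (hcoker : ∀ j, quotientHilbert ℳ (LinearMap.range ψ) ⊤ j ≤ C * (j + 1) ^ D)
    (hker : ∀ j, quotientHilbert ℳ' ⊥ (LinearMap.ker ψ) j ≤ C * (j + 1) ^ D) (c : ℕ) :
    ∃ A, ∀ n m, m ≤ c * p ^ n →
      Module.finrank k ((ℳ' m ⊓ ((frobeniusPower I (p ^ n) • (⊤ : Submodule R M)).comap
        ψ).restrictScalars k).map
          ((frobeniusPower I (p ^ n) • (⊤ : Submodule R M')).mkQ.restrictScalars k)) ≤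
        A * (p ^ n) ^ D := by
  classical
  obtain ⟨X, hX, hspan⟩ := (Submodule.fg_span_iff_fg_span_finset_subset (R := R)
    (𝒜 1 : Set R)).mp (IsNoetherian.noetherian _)
  obtain ⟨G, hG⟩ := IsNoetherian.noetherian I
  set F := G ∪ X.image (fun x => x ^ N) with hF
  have hIF : I = Ideal.span (F : Set R) := by
    rw [hF, Finset.coe_union, Ideal.span_union]
    change Ideal.span (G : Set R) = I at hG
    rw [hG, left_eq_sup, Ideal.span_le]
    intro z hz
    obtain ⟨x, hx, rfl⟩ := Finset.mem_image.mp (Finset.mem_coe.mp hz)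
    exact hI (Ideal.pow_mem_pow (Ideal.subset_span (hX hx)) N)
  have hXF : ∀ x ∈ X, x ^ N ∈ F := fun x hx =>
    Finset.mem_union_right _ (Finset.mem_image_of_mem _ hx)
  obtain ⟨B, hB⟩ := exists_mem_span_pow_smul 𝒜 ℳ hstd p hX hspan hXF c
  obtain ⟨Δ, hΔ⟩ := exists_pow_smul_mem_iSup 𝒜 ℳ' p F
  obtain ⟨B', hB'⟩ : ∃ B', B' = B + Δ + c := ⟨_, rfl⟩
  refine ⟨F.card * ((B + 1) * (C * (B + 1) ^ D)) + (B' + 1) * (C * (B' + 1) ^ D),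
    fun n m hm => ?_⟩
  have hB := hB n m hm
  have hΔ := fun f hf => hΔ f hf n
  have hJF : frobeniusPower I (p ^ n) = Ideal.span ((fun f => f ^ p ^ n) '' (F : Set R)) := by
    conv_lhs => rw [hIF]
    rw [frobeniusPower_span]
  have hq : 0 < p ^ n := pow_pos (expChar_pos R p) n
  generalize p ^ n = q at *
  generalize frobeniusPower I q = J at *
  have hmod : ∀ l j : ℕ, q * l + j ≡ j [MOD q] := fun l j => by simp [Nat.ModEq]
  have key := finrank_map_mkQ_le_sum ℳ ℳ' hψ J (F := F.image fun f => f ^ q)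
    (S := {j ∈ Finset.range (B * q + 1) | j ≡ m [MOD q]})
    (S' := {j ∈ Finset.range (B' * q + 1) | j ≡ m [MOD q]}) (m := m) ?_ ?_ ?_ ?_
  · refine key.trans ?_
    rw [add_mul _ _ (q ^ D), mul_assoc F.card]
    exact add_le_add (Nat.mul_le_mul Finset.card_image_le (sum_filter_modEq_le hcoker B m hq))
      (sum_filter_modEq_le hker B' m hq)
  · intro g hg
    obtain ⟨f, hf, rfl⟩ := Finset.mem_image.mp hg
    rw [hJF]
    exact Ideal.subset_span ⟨f, hf, rfl⟩
  · refine Finset.mem_filter.mpr ⟨Finset.mem_range.mpr ?_, rfl⟩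
    have : c * q ≤ B' * q := Nat.mul_le_mul_right q (by omega)
    omega
  · intro y hy hyJ
    refine Submodule.span_mono ?_ (hB y hy (hJF ▸ hyJ))
    rintro _ ⟨f, hf, j, hj, hjm, w, hw, rfl⟩
    exact ⟨f ^ q, Finset.mem_image_of_mem _ hf, j, Finset.mem_filter.mpr
      ⟨Finset.mem_range.mpr (Nat.lt_succ_of_le hj), hjm⟩, w, hw, rfl⟩
  · intro g hg j hj w hw
    obtain ⟨f, hf, rfl⟩ := Finset.mem_image.mp hg
    obtain ⟨hj, hjm⟩ := Finset.mem_filter.mp hj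
    have hj := Finset.mem_range.mp hj
    have hle : (⨆ i ∈ {i | ∃ l ≤ Δ, i = q * l + j}, ℳ' i) ≤
        ({j ∈ Finset.range (B' * q + 1) | j ≡ m [MOD q]} : Finset ℕ).sup ℳ' :=
      iSup₂_le fun i hi => Finset.le_sup ?_
    · exact hle (hΔ f hf j w hw)
    obtain ⟨l, hl, rfl⟩ := hi
    refine Finset.mem_filter.mpr ⟨Finset.mem_range.mpr ?_, (hmod l j).trans hjm⟩
    have h1 : q * l ≤ q * Δ := Nat.mul_le_mul_left q hl
    have h2 : B' * q = B * q + q * Δ + c * q := by rw [hB']; ring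
    omega

end Comparison

section Main

open DirectSum

/-- If `e` is idempotent modulo `J`, images modulo `JM` are controlled by the images modulo
`(J + (e))M` and modulo `(J + (1 - e))M`. -/
lemma finrank_map_mkQ_le_of_idempotent {k R M : Type*} [Field k] [CommRing R] [Algebra k R]
    [AddCommGroup M] [Module R M] [Module k M] [IsScalarTower k R M] {J : Ideal R} {e : R}
    (he : e - e ^ 2 ∈ J) (X : Submodule k M) [FiniteDimensional k X] :
    Module.finrank k (X.map ((J • (⊤ : Submodule R M)).mkQ.restrictScalars k)) ≤
      Module.finrank k (X.map
        (((J ⊔ Ideal.span {e}) • (⊤ : Submodule R M)).mkQ.restrictScalars k)) +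
      Module.finrank k (X.map
        (((J ⊔ Ideal.span {1 - e}) • (⊤ : Submodule R M)).mkQ.restrictScalars k)) := by
  have hle : ∀ r : R, J • (⊤ : Submodule R M) ≤ (J ⊔ Ideal.span {r}) • (⊤ : Submodule R M) :=
    fun r => Submodule.smul_mono_left le_sup_left
  let f : ∀ r : R, (M ⧸ J • (⊤ : Submodule R M)) →ₗ[k]
      (M ⧸ (J ⊔ Ideal.span {r}) • (⊤ : Submodule R M)) := fun r =>
    (Submodule.factor (hle r)).restrictScalars k
  set Z := X.map ((J • (⊤ : Submodule R M)).mkQ.restrictScalars k) with hZ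
  have hmap : ∀ r : R, Z.map (f r) = X.map
      (((J ⊔ Ideal.span {r}) • (⊤ : Submodule R M)).mkQ.restrictScalars k) := by
    intro r
    rw [hZ, ← Submodule.map_comp]
    rfl
  set Y := Z ⊓ LinearMap.ker (f e)
  have hY : FiniteDimensional k Y := Submodule.finiteDimensional_of_le inf_le_left
  have h1 : Module.finrank k Z ≤ Module.finrank k (Z.map (f e)) + Module.finrank k Y :=
    Submodule.finrank_le_finrank_map_add Z Y (f e) fun x hx h0 => ⟨hx, h0⟩
  have h2 : Module.finrank k Y ≤ Module.finrank k (Y.map (f (1 - e))) +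
      Module.finrank k (⊥ : Submodule k (M ⧸ J • (⊤ : Submodule R M))) := by
    refine Submodule.finrank_le_finrank_map_add Y ⊥ (f (1 - e)) ?_
    rintro _ ⟨⟨x, -, rfl⟩, hx⟩ hx'
    have hx1 : x ∈ (J ⊔ Ideal.span {e}) • (⊤ : Submodule R M) :=
      (Submodule.Quotient.mk_eq_zero _).mp hx
    have hx2 : x ∈ (J ⊔ Ideal.span {1 - e}) • (⊤ : Submodule R M) :=
      (Submodule.Quotient.mk_eq_zero _).mp hx'
    exact (Submodule.Quotient.mk_eq_zero _).mpr (mem_smul_top_of_idempotent he hx1 hx2)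
  have h3 : Module.finrank k (Y.map (f (1 - e))) ≤ Module.finrank k (Z.map (f (1 - e))) :=
    Submodule.finrank_mono (Submodule.map_mono inf_le_left)
  rw [finrank_bot] at h2
  rw [hmap] at h1 h3
  omega

variable {k R M M' : Type*} [Field k] [CommRing R] [Algebra k R] [AddCommGroup M] [Module R M]
  [Module k M] [IsScalarTower k R M] (ℳ : ℕ → Submodule k M) [∀ m, FiniteDimensional k (ℳ m)]
  [AddCommGroup M'] [Module R M'] [Module k M'] [IsScalarTower k R M']
  (ℳ' : ℕ → Submodule k M') [∀ m, FiniteDimensional k (ℳ' m)] {ψ : M' →ₗ[R] M}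

lemma finrank_map_mkQ_le_add_ker (hψ : ∀ m : ℕ, ∀ x ∈ ℳ' m, ψ x ∈ ℳ m) (J : Ideal R) (m : ℕ) :
    Module.finrank k ((ℳ' m).map ((J • (⊤ : Submodule R M')).mkQ.restrictScalars k)) ≤
      Module.finrank k ((ℳ m).map ((J • (⊤ : Submodule R M)).mkQ.restrictScalars k)) +
        Module.finrank k ((ℳ' m ⊓ ((J • (⊤ : Submodule R M)).comap ψ).restrictScalars k).map
          ((J • (⊤ : Submodule R M')).mkQ.restrictScalars k)) := by
  have hle : J • (⊤ : Submodule R M') ≤ (J • (⊤ : Submodule R M)).comap ψ := by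
    rw [← Submodule.map_le_iff_le_comap, Submodule.map_smul'']
    exact Submodule.smul_mono le_rfl le_top
  let f := (Submodule.mapQ _ _ ψ hle).restrictScalars k
  set X := ℳ' m ⊓ ((J • (⊤ : Submodule R M)).comap ψ).restrictScalars k
  have : FiniteDimensional k X := Submodule.finiteDimensional_of_le inf_le_left
  refine (Submodule.finrank_le_finrank_map_add _
    (X.map ((J • (⊤ : Submodule R M')).mkQ.restrictScalars k)) f ?_).trans
    (Nat.add_le_add_right (Submodule.finrank_mono ?_) _)
  · rintro _ ⟨x, hx, rfl⟩ h0
    have hx' : ψ x ∈ J • (⊤ : Submodule R M) := (Submodule.Quotient.mk_eq_zero _).mp h0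
    exact Submodule.mem_map_of_mem (Submodule.mem_inf.mpr ⟨hx, hx'⟩)
  · rintro _ ⟨_, ⟨x, hx, rfl⟩, rfl⟩
    exact Submodule.mem_map.mpr ⟨ψ x, hψ m x hx, rfl⟩

/-- The dimension of the part of the degree `m` component of `M'/I^{[q]}M'` dying in
`M/I^{[q]}M` is `O(q ^ D)` for `m = O(q)`. -/
lemma exists_finrank_map_mkQ_le [Infinite k] [IsNoetherianRing R] [IsNoetherian R M]
    [Decomposition ℳ] [Decomposition ℳ'] (𝒜 : ℕ → Submodule k R) [GradedAlgebra 𝒜]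
    [SetLike.GradedSMul 𝒜 ℳ'] [SetLike.GradedSMul 𝒜 ℳ]
    (hstd : ∀ m : ℕ, (𝒜 (m + 1) : Set R) ⊆
      Submodule.span k (Set.image2 (· * ·) (𝒜 1 : Set R) (𝒜 m : Set R)))
    (p : ℕ) [ExpChar R p] (hψ : ∀ m : ℕ, ∀ x ∈ ℳ' m, ψ x ∈ ℳ m) (I : Ideal R)
    [Module.Finite k (R ⧸ I)] {C D : ℕ}
    (hcoker : ∀ j, quotientHilbert ℳ (LinearMap.range ψ) ⊤ j ≤ C * (j + 1) ^ D)
    (hker : ∀ j, quotientHilbert ℳ' ⊥ (LinearMap.ker ψ) j ≤ C * (j + 1) ^ D)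
    {e : ℕ} {a : R} (ha : a ∈ 𝒜 e) (hak : ∀ x, ψ x = 0 → a • x = 0)
    (hac : ∀ y, a • y ∈ LinearMap.range ψ)
    (haC : ∀ j, quotientHilbert ℳ' ((⊤ : Submodule R M').map (LinearMap.lsmul R M' (a ^ 2))) ⊤ j ≤
      C * (j + 1) ^ D) (c : ℕ) :
    ∃ A, ∀ n m, m ≤ c * p ^ n →
      Module.finrank k ((ℳ' m ⊓ ((frobeniusPower I (p ^ n) • (⊤ : Submodule R M)).comap
        ψ).restrictScalars k).map
          ((frobeniusPower I (p ^ n) • (⊤ : Submodule R M')).mkQ.restrictScalars k)) ≤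
        A * (p ^ n) ^ D := by
  obtain ⟨u, hu, v, huv, N, hN⟩ := exists_idempotent_linearForm 𝒜 I
  obtain ⟨A, hA⟩ := exists_finrank_map_mkQ_le_of_pow_le ℳ ℳ' 𝒜 hstd p hψ _ hN hcoker hker c
  refine ⟨A + C * (e * 2 + c + 1) ^ D, fun n m hm => ?_⟩
  have hA := hA n m hm
  rw [frobeniusPower_sup_span_singleton] at hA
  have hq : 0 < p ^ n := pow_pos (expChar_pos R p) n
  have hφ : iterateFrobenius R p n (v * u) - iterateFrobenius R p n (v * u) ^ 2 ∈
      frobeniusPower I (p ^ n) := by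
    rw [← map_pow, ← map_sub, iterateFrobenius_def]
    exact Ideal.subset_span ⟨_, huv, rfl⟩
  have hfac : iterateFrobenius R p n (v * u) = v ^ p ^ n * u ^ (p ^ n - 1) * u := by
    rw [iterateFrobenius_def, mul_pow, mul_assoc, ← pow_succ, Nat.sub_add_cancel hq]
  generalize frobeniusPower I (p ^ n) = J at *
  generalize iterateFrobenius R p n (v * u) = ε at *
  generalize p ^ n = q at *
  have hmono : ∀ r : R, ℳ' m ⊓ ((J • (⊤ : Submodule R M)).comap ψ).restrictScalars k ≤
      ℳ' m ⊓ (((J ⊔ Ideal.span {r}) • (⊤ : Submodule R M)).comap ψ).restrictScalars k := by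
    rintro r x ⟨hx, hxJ⟩
    exact Submodule.mem_inf.mpr
      ⟨hx, (Submodule.smul_mono_left le_sup_left : J • (⊤ : Submodule R M) ≤ _) hxJ⟩
  have hfin : ∀ J' : Ideal R, FiniteDimensional k
      ↥(ℳ' m ⊓ ((J' • (⊤ : Submodule R M)).comap ψ).restrictScalars k) := fun J' =>
    Submodule.finiteDimensional_of_le inf_le_left
  have hunit := finrank_map_mkQ_le_of_unit (ψ := ψ) ℳ' 𝒜 (J ⊔ Ideal.span {1 - ε}) hu
    (v := v ^ q * u ^ (q - 1))
    (by rw [← hfac]; exact Ideal.mem_sup_right (Ideal.mem_span_singleton_self _)) ha hak hac m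
  have hbound : C * (e * 2 + m + 1) ^ D ≤ C * (e * 2 + c + 1) ^ D * q ^ D := by
    rw [mul_assoc, ← mul_pow]
    gcongr
    nlinarith
  calc _ ≤ _ := finrank_map_mkQ_le_of_idempotent hφ _
    _ ≤ _ := add_le_add (Submodule.finrank_mono (Submodule.map_mono (hmono ε)))
        (Submodule.finrank_mono (Submodule.map_mono (hmono (1 - ε))))
    _ ≤ A * q ^ D + C * (e * 2 + c + 1) ^ D * q ^ D :=
        add_le_add hA (hunit.trans ((haC _).trans hbound))
    _ = _ := (add_mul _ _ _).symm

/-- The graded pieces of `M'/I^{[q]}M'` and `M/I^{[q]}M` in degree `O(q)` have lengths differing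
by `O(q ^ D)` if the kernel and the cokernel of `M' → M` have dimension at most `D + 1`. -/
lemma exists_gradedPieceLength_le [Infinite k] [IsNoetherianRing R] [IsNoetherian R M]
    [IsNoetherian R M'] [Decomposition ℳ] [Decomposition ℳ'] (𝒜 : ℕ → Submodule k R)
    [GradedAlgebra 𝒜] [FiniteDimensional k (𝒜 0)]
    [SetLike.GradedSMul 𝒜 ℳ'] [SetLike.GradedSMul 𝒜 ℳ]
    (hstd : ∀ m : ℕ, (𝒜 (m + 1) : Set R) ⊆
      Submodule.span k (Set.image2 (· * ·) (𝒜 1 : Set R) (𝒜 m : Set R)))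
    (p : ℕ) [ExpChar R p] (hψ : ∀ m : ℕ, ∀ x ∈ ℳ' m, ψ x ∈ ℳ m) (I : Ideal R)
    [Module.Finite k (R ⧸ I)] {D : ℕ} (hR : ChainBound (⊥ : Ideal R) (D + 2))
    (hker : ChainBound (Module.annihilator R (LinearMap.ker ψ)) (D + 1))
    (hcoker : ChainBound (Module.annihilator R (M ⧸ LinearMap.range ψ)) (D + 1)) (c : ℕ) :
    ∃ A, ∀ n m, m ≤ c * p ^ n →
      gradedPieceLength ℳ' I (p ^ n) m ≤ gradedPieceLength ℳ I (p ^ n) m + A * (p ^ n) ^ D ∧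
      gradedPieceLength ℳ I (p ^ n) m ≤ gradedPieceLength ℳ' I (p ^ n) m + A * (p ^ n) ^ D := by
  set 𝔨 := Module.annihilator R (LinearMap.ker ψ)
  set 𝔠 := Module.annihilator R (M ⧸ LinearMap.range ψ)
  have h𝔨 : ∀ r, r ∈ 𝔨 ↔ ∀ x ∈ LinearMap.ker ψ, r • x ∈ (⊥ : Submodule R M') := fun r =>
    Submodule.mem_annihilator
  have h𝔠 : ∀ r, r ∈ 𝔠 ↔ ∀ y ∈ (⊤ : Submodule R M), r • y ∈ LinearMap.range ψ := by
    intro r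
    rw [Module.mem_annihilator]
    constructor
    · intro h y _
      exact (Submodule.Quotient.mk_eq_zero _).mp (h (Submodule.Quotient.mk y))
    · intro h y
      obtain ⟨y, rfl⟩ := Submodule.Quotient.mk_surjective _ y
      exact (Submodule.Quotient.mk_eq_zero _).mpr (h y trivial)
  have hbot : (⊥ : Submodule R M').IsHomogeneous ℳ' := by
    intro i x hx
    rw [(Submodule.mem_bot R).mp hx, decompose_zero]
    exact Submodule.zero_mem _
  have htop : (⊤ : Submodule R M).IsHomogeneous ℳ := fun _ _ _ => trivial
  have htop' : (⊤ : Submodule R M').IsHomogeneous ℳ' := fun _ _ _ => trivial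
  have hkerhom := isHomogeneous_ker ℳ' ℳ hψ
  have hranhom := isHomogeneous_range ℳ' ℳ hψ
  have hinf : ChainBound (𝔨 ⊓ 𝔠) (D + 1) := fun l hl =>
    ((l.head.2.inf_le).mp hl).elim (hker l) (hcoker l)
  obtain ⟨e, a, ha, ⟨hak, hac⟩, haD⟩ := exists_homogeneous_chainBound 𝒜 hstd (𝔞 := 𝔨 ⊓ 𝔠)
    (fun j r hr => ⟨(h𝔨 _).mpr (gradedProj_smul_mem_of_forall_smul_mem 𝒜 hbot hkerhom
      ((h𝔨 r).mp hr.1) j), (h𝔠 _).mpr (gradedProj_smul_mem_of_forall_smul_mem 𝒜 hranhom htop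
      ((h𝔠 r).mp hr.2) j)⟩) hR hinf
  have haD2 : ChainBound (Ideal.span {a ^ 2}) (D + 1) := fun l hl => haD l <| by
    rw [Ideal.span_singleton_le_iff_mem] at hl ⊢
    exact l.head.2.mem_of_pow_mem 2 hl
  obtain ⟨C₁, hC₁⟩ := exists_quotientHilbert_le 𝒜 ℳ hstd hcoker hranhom htop
    (Submodule.smul_le.mpr fun r hr y hy => (h𝔠 r).mp hr y hy)
  obtain ⟨C₂, hC₂⟩ := exists_quotientHilbert_le 𝒜 ℳ' hstd hker hbot hkerhom
    (Submodule.smul_le.mpr fun r hr y hy => (h𝔨 r).mp hr y hy)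
  obtain ⟨C₃, hC₃⟩ := exists_quotientHilbert_le 𝒜 ℳ' hstd haD2
    (N := (⊤ : Submodule R M').map (LinearMap.lsmul R M' (a ^ 2)))
    (htop'.map_lsmul 𝒜 (SetLike.pow_mem_graded 2 ha)) htop' (by
      rw [Submodule.ideal_span_singleton_smul]
      exact le_rfl)
  set C := C₁ + C₂ + C₃ with hC
  have hle : ∀ {C' h j : ℕ}, C' ≤ C → h ≤ C' * (j + 1) ^ D → h ≤ C * (j + 1) ^ D :=
    fun h1 h2 => h2.trans (Nat.mul_le_mul_right _ h1)
  obtain ⟨A, hA⟩ := exists_finrank_map_mkQ_le ℳ ℳ' 𝒜 hstd p hψ I (C := C)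
    (fun j => hle (by omega) (hC₁ j)) (fun j => hle (by omega) (hC₂ j)) ha
    (fun x hx => (Submodule.mem_bot R).mp ((h𝔨 a).mp hak x hx))
    (fun y => (h𝔠 a).mp hac y trivial) (fun j => hle (by omega) (hC₃ j)) c
  refine ⟨A + C₁ * (c + 1) ^ D, fun n m hm => ⟨?_, ?_⟩⟩
  · refine (finrank_map_mkQ_le_add_ker ℳ ℳ' hψ _ m).trans (Nat.add_le_add_left ?_ _)
    exact (hA n m hm).trans (Nat.mul_le_mul_right _ (Nat.le_add_right _ _))
  · refine (finrank_map_mkQ_le_add_range ℳ ℳ' hψ _ m).trans (Nat.add_le_add_left ?_ _)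
    refine (hC₁ m).trans ?_
    have hq : 0 < p ^ n := pow_pos (expChar_pos R p) n
    calc C₁ * (m + 1) ^ D ≤ C₁ * ((c + 1) * p ^ n) ^ D := by
          gcongr
          linarith
      _ = C₁ * (c + 1) ^ D * (p ^ n) ^ D := by rw [mul_pow, mul_assoc]
      _ ≤ _ := Nat.mul_le_mul_right _ (Nat.le_add_left _ _)

end Main

/-- Generic isomorphisms do not change the HK density function: if `ψ : M' → M''` is a
degree-preserving map of finitely generated graded modules over a standard graded ring of
dimension `d ≥ 2` whose kernel and cokernel have dimension `< d`, then
`HKd(M', I) = HKd(M'', I)`, i.e. the difference of the approximating functions tends to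
zero at every point. -/
theorem stmt15
    (k : Type*) [Field k] (p : ℕ) (hp : p.Prime) [CharP k p] [IsAlgClosed k]
    (R : Type*) [CommRing R] [IsNoetherianRing R] [Algebra k R]
    (𝒜 : ℕ → Submodule k R) [GradedAlgebra 𝒜] [∀ m, FiniteDimensional k (𝒜 m)]
    (hstd : ∀ m : ℕ, (𝒜 (m + 1) : Set R) ⊆
      Submodule.span k (Set.image2 (· * ·) (𝒜 1 : Set R) (𝒜 m : Set R)))
    (d : ℕ) (hd : 2 ≤ d) (hdim : ringKrullDim R = d)
    (I : Ideal R) [Module.Finite k (R ⧸ I)]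
    (M' M'' : Type*)
    [AddCommGroup M'] [Module R M'] [Module k M'] [IsScalarTower k R M'] [Module.Finite R M']
    [AddCommGroup M''] [Module R M''] [Module k M''] [IsScalarTower k R M''] [Module.Finite R M'']
    (ℳ' : ℕ → Submodule k M') [SetLike.GradedSMul 𝒜 ℳ'] [DirectSum.Decomposition ℳ']
    [∀ m, FiniteDimensional k (ℳ' m)]
    (ℳ'' : ℕ → Submodule k M'') [SetLike.GradedSMul 𝒜 ℳ''] [DirectSum.Decomposition ℳ'']
    [∀ m, FiniteDimensional k (ℳ'' m)]
    (ψ : M' →ₗ[R] M'')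
    -- `ψ` is degree-preserving
    (hψ : ∀ m : ℕ, ∀ x ∈ ℳ' m, ψ x ∈ ℳ'' m)
    -- kernel and cokernel of `ψ` have dimension `< d`
    (hker : ringKrullDim (R ⧸ Module.annihilator R (LinearMap.ker ψ)) < (d : WithBot ℕ∞))
    (hcoker : ringKrullDim (R ⧸ Module.annihilator R (M'' ⧸ LinearMap.range ψ)) <
      (d : WithBot ℕ∞)) :
    ∀ x : ℝ, Tendsto (fun n : ℕ => hkStep ℳ' I d p n x - hkStep ℳ'' I d p n x)
      atTop (nhds 0) := by
  obtain ⟨D, rfl⟩ : ∃ D, d = D + 2 := ⟨d - 2, by omega⟩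
  have : Nontrivial R := by
    rw [← not_subsingleton_iff_nontrivial]
    intro h
    rw [ringKrullDim_eq_bot_of_subsingleton] at hdim
    exact absurd hdim.symm (WithBot.natCast_ne_bot _)
  have : CharP R p := charP_of_injective_algebraMap (algebraMap k R).injective p
  have : ExpChar R p := ExpChar.prime hp
  have hlt : ∀ {t : WithBot ℕ∞}, t < ((D + 2 : ℕ) : WithBot ℕ∞) →
      t ≤ ((D + 1 : ℕ) : WithBot ℕ∞) := by
    intro t h
    induction t with
    | bot => exact bot_le
    | coe t =>
      have h' : t < ((D + 1 : ℕ) : ℕ∞) + 1 := WithBot.coe_lt_coe.mp h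
      exact WithBot.coe_le_coe.mpr (Order.le_of_lt_add_one h')
  intro x
  rcases lt_or_ge x 0 with hx | hx
  · simp [hkStep, hx]
  obtain ⟨A, hA⟩ := exists_gradedPieceLength_le ℳ'' ℳ' 𝒜 hstd p hψ I
    (chainBound_bot_of_ringKrullDim_le hdim.le)
    (chainBound_of_ringKrullDim_quotient_le (hlt hker))
    (chainBound_of_ringKrullDim_quotient_le (hlt hcoker)) ⌈x⌉₊
  have hp1 : (1 : ℝ) < p := mod_cast hp.one_lt
  refine squeeze_zero_norm (a := fun n => (A : ℝ) * (p⁻¹ : ℝ) ^ n) (fun n => ?_) ?_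
  · have hq : (0 : ℝ) < (p : ℝ) ^ n := by positivity
    obtain ⟨h1, h2⟩ := hA n ⌊x * (p : ℝ) ^ n⌋₊ (Nat.floor_le_of_le (by
      push_cast
      exact mul_le_mul_of_nonneg_right (Nat.le_ceil x) hq.le))
    rw [hkStep, hkStep, if_neg hx.not_gt, if_neg hx.not_gt, ← sub_div, Real.norm_eq_abs, abs_div,
      abs_of_pos (pow_pos (zero_lt_one.trans hp1) _), div_le_iff₀ (by positivity)]
    have h3 : (A : ℝ) * (p⁻¹ : ℝ) ^ n * (p : ℝ) ^ (n * (D + 2 - 1)) = A * ((p : ℝ) ^ n) ^ D := by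
      rw [show n * (D + 2 - 1) = n + n * D by rw [show D + 2 - 1 = D + 1 by omega]; ring, pow_add,
        inv_pow, pow_mul]
      field_simp
    rw [h3, abs_sub_le_iff]
    have h1' := (Nat.cast_le (α := ℝ)).mpr h1
    have h2' := (Nat.cast_le (α := ℝ)).mpr h2
    push_cast at h1' h2'
    constructor <;> linarith
  · simpa using (tendsto_pow_atTop_nhds_zero_of_lt_one (by positivity)
      (inv_lt_one_of_one_lt₀ hp1)).const_mul (A : ℝ)
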